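/- arXiv:1103.0849 — 5 statements merged into one kernel-verified Lean document; each statement's English description precedes it below -/
import Mathlib

section
/- Let 1 ≤ k ≤ n − 1 and let f₁,…,f_{2n−2k} be smooth functions on an open subset W of ℝ^{2n} such that the (2n−2k)×(2n−2k) matrix M(x) with entries {f_i,f_j}₀(x) is invertible for every x ∈ W; let (c_{ij}) denote the (smooth) entries of its inverse. Define the Dirac bracket {g,h}_D = {g,h}₀ + Σ_{i,j} c_{ij} {f_i,g}₀ {f_j,h}₀ for smooth functions g,h on W. Then {·,·}_D satisfies the Jacobi identity {g,{h,k}_D}_D + {h,{k,g}_D}_D + {k,{g,h}_D}_D = 0 for all smooth g,h,k on W, and each f_l (l = 1,…,2n−2k) is a Casimir of {·,·}_D, i.e. {f_l,h}_D = 0 for every smooth h. -/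
/-!
STATEMENT 13.  The Dirac bracket
`{g,h}_D = {g,h}₀ + Σ_{i,j} c_{ij} {f_i,g}₀ {f_j,h}₀`
(with `(c_{ij})` the smooth inverse of the matrix `({f_i,f_j}₀)`, invertible on `W`)
satisfies the Jacobi identity on `W` and admits each `f_l` as a Casimir on `W`.
-/

namespace Damianou13

noncomputable section

/-- Phase space `ℝ^{2n}` with coordinates `(q₁,…,q_n,p₁,…,p_n)`. -/
abbrev P (n : ℕ) := (Fin n → ℝ) × (Fin n → ℝ)

/-- `∂g/∂q_s`. -/
def pdq {n : ℕ} (g : P n → ℝ) (s : Fin n) (z : P n) : ℝ :=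
  fderiv ℝ g z (Pi.single s 1, 0)

/-- `∂g/∂p_s`. -/
def pdp {n : ℕ} (g : P n → ℝ) (s : Fin n) (z : P n) : ℝ :=
  fderiv ℝ g z (0, Pi.single s 1)

/-- The canonical Poisson bracket on `ℝ^{2n}`. -/
def bra0 {n : ℕ} (g h : P n → ℝ) : P n → ℝ :=
  fun z => ∑ s, (pdq g s z * pdp h s z - pdp g s z * pdq h s z)

/-- The Dirac bracket `{g,h}_D = {g,h}₀ + Σ_{i,j} c_{ij} {f_i,g}₀ {f_j,h}₀`. -/
def braD {n m : ℕ} (f : Fin m → P n → ℝ) (c : Fin m → Fin m → P n → ℝ)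
    (g h : P n → ℝ) : P n → ℝ :=
  fun z => bra0 g h z + ∑ i, ∑ j, c i j z * bra0 (f i) g z * bra0 (f j) h z

/-- The Hamiltonian vector of a covector: the canonical bracket is
`{g,h}₀ = dh (hamVec dg)`. -/
def hamVec (n : ℕ) : (P n →L[ℝ] ℝ) →L[ℝ] P n :=
  ∑ s, ((ContinuousLinearMap.apply ℝ ℝ ((Pi.single s 1, 0) : P n)).smulRight
      ((0, Pi.single s 1) : P n) -
    (ContinuousLinearMap.apply ℝ ℝ ((0, Pi.single s 1) : P n)).smulRight
      ((Pi.single s 1, 0) : P n))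

lemma apply_hamVec {n : ℕ} (φ ψ : P n →L[ℝ] ℝ) :
    ψ (hamVec n φ) = ∑ s, (φ (Pi.single s 1, 0) * ψ (0, Pi.single s 1) -
      φ (0, Pi.single s 1) * ψ (Pi.single s 1, 0)) := by
  simp only [hamVec, sum_apply, map_sum, sub_apply, map_sub,
    ContinuousLinearMap.smulRight_apply, ContinuousLinearMap.apply_apply, map_smul, smul_eq_mul]

lemma bra0_eq_fderiv_hamVec {n : ℕ} (g h : P n → ℝ) (z : P n) :
    bra0 g h z = fderiv ℝ h z (hamVec n (fderiv ℝ g z)) :=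
  (apply_hamVec _ _).symm

lemma apply_hamVec_antisymm {n : ℕ} (φ ψ : P n →L[ℝ] ℝ) :
    ψ (hamVec n φ) = -φ (hamVec n ψ) := by
  simp only [apply_hamVec, ← Finset.sum_neg_distrib]
  exact Finset.sum_congr rfl fun s _ => by ring

lemma bra0_antisymm {n : ℕ} (g h : P n → ℝ) (z : P n) : bra0 g h z = -bra0 h g z := by
  simp only [bra0_eq_fderiv_hamVec]
  exact apply_hamVec_antisymm _ _

lemma hasFDerivAt_bra0 {n : ℕ} {g h : P n → ℝ} {z : P n}
    (hg : ContDiffAt ℝ 2 g z) (hh : ContDiffAt ℝ 2 h z) :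
    HasFDerivAt (bra0 g h)
      ((fderiv ℝ h z).comp ((hamVec n).comp (fderiv ℝ (fderiv ℝ g) z)) +
        (fderiv ℝ (fderiv ℝ h) z).flip (hamVec n (fderiv ℝ g z))) z := by
  have differentiableAt_fderiv {u : P n → ℝ} (hu : ContDiffAt ℝ 2 u z) :
      DifferentiableAt ℝ (fderiv ℝ u) z :=
    (hu.fderiv_right (m := 1) (by norm_num)).differentiableAt (by norm_num)
  rw [show bra0 g h = fun y => fderiv ℝ h y (hamVec n (fderiv ℝ g y)) from
    funext (bra0_eq_fderiv_hamVec g h)]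
  exact (differentiableAt_fderiv hh).hasFDerivAt.clm_apply
    ((hamVec n).hasFDerivAt.comp z (differentiableAt_fderiv hg).hasFDerivAt)

lemma bra0_bra0 {n : ℕ} (g : P n → ℝ) {h k : P n → ℝ} {z : P n}
    (hh : ContDiffAt ℝ 2 h z) (hk : ContDiffAt ℝ 2 k z) :
    bra0 g (bra0 h k) z =
      fderiv ℝ (fderiv ℝ k) z (hamVec n (fderiv ℝ g z)) (hamVec n (fderiv ℝ h z)) -
      fderiv ℝ (fderiv ℝ h) z (hamVec n (fderiv ℝ g z)) (hamVec n (fderiv ℝ k z)) := by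
  rw [bra0_eq_fderiv_hamVec, (hasFDerivAt_bra0 hh hk).fderiv]
  simp only [add_apply, ContinuousLinearMap.comp_apply,
    ContinuousLinearMap.flip_apply]
  rw [apply_hamVec_antisymm _ (fderiv ℝ k z)]
  ring

lemma bra0_jacobi {n : ℕ} {g h k : P n → ℝ} {z : P n} (hg : ContDiffAt ℝ 2 g z)
    (hh : ContDiffAt ℝ 2 h z) (hk : ContDiffAt ℝ 2 k z) :
    bra0 g (bra0 h k) z + bra0 h (bra0 k g) z + bra0 k (bra0 g h) z = 0 := by
  have symm {u : P n → ℝ} (hu : ContDiffAt ℝ 2 u z) (v w : P n) :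
      fderiv ℝ (fderiv ℝ u) z v w = fderiv ℝ (fderiv ℝ u) z w v :=
    (hu.isSymmSndFDerivAt (by simp)).eq v w
  rw [bra0_bra0 g hh hk, bra0_bra0 h hk hg, bra0_bra0 k hg hh,
    symm hg (hamVec n (fderiv ℝ h z)), symm hh (hamVec n (fderiv ℝ g z)),
    symm hk (hamVec n (fderiv ℝ g z))]
  ring

lemma bra0_add_sum_left {n m : ℕ} {f : Fin m → P n → ℝ} {g : P n → ℝ} {z : P n}
    (hg : DifferentiableAt ℝ g z) (hf : ∀ i, DifferentiableAt ℝ (f i) z)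
    (a : Fin m → ℝ) (h : P n → ℝ) :
    bra0 (fun y => g y + ∑ i, a i * f i y) h z = bra0 g h z + ∑ i, a i * bra0 (f i) h z := by
  have hderiv : fderiv ℝ (fun y => g y + ∑ i, a i * f i y) z =
      fderiv ℝ g z + ∑ i, a i • fderiv ℝ (f i) z :=
    (hg.hasFDerivAt.add (HasFDerivAt.fun_sum fun i _ =>
      (hf i).hasFDerivAt.const_mul (a i))).fderiv
  simp [bra0_eq_fderiv_hamVec, hderiv, map_sum]

lemma braD_congr_right {n m : ℕ} (f : Fin m → P n → ℝ) (c : Fin m → Fin m → P n → ℝ)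
    (g : P n → ℝ) {h h' : P n → ℝ} {z : P n} (H : h =ᶠ[nhds z] h') :
    braD f c g h z = braD f c g h' z := by
  simp only [braD, bra0_eq_fderiv_hamVec, H.fderiv_eq]

section Inverse

variable {n m : ℕ} {f : Fin m → P n → ℝ} {c : Fin m → Fin m → P n → ℝ} {z : P n}

/-- The functions `c i j` are at `z` the entries of the inverse of the matrix of brackets. -/
def IsInvAt (f : Fin m → P n → ℝ) (c : Fin m → Fin m → P n → ℝ) (z : P n) : Prop :=
  (Matrix.of fun i j => bra0 (f i) (f j) z) * (Matrix.of fun i j => c i j z) = 1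

lemma IsInvAt.antisymm (H : IsInvAt f c z) (i j : Fin m) : c i j z = -c j i z := by
  unfold IsInvAt at H
  set M : Matrix (Fin m) (Fin m) ℝ := Matrix.of fun i j => bra0 (f i) (f j) z
  set C : Matrix (Fin m) (Fin m) ℝ := Matrix.of fun i j => c i j z
  have hM : M.transpose = -M := by
    ext i j
    exact bra0_antisymm _ _ _
  have hC : C.transpose * M = -1 := by
    have := congrArg Matrix.transpose H
    rw [Matrix.transpose_mul, hM, Matrix.transpose_one, mul_neg] at this
    rw [← this, neg_neg]
  have : C.transpose = -C := by
    calc C.transpose = C.transpose * (M * C) := by rw [H, mul_one]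
      _ = -C := by rw [← mul_assoc, hC, neg_one_mul]
  exact congrFun (congrFun this j) i

lemma IsInvAt.sum_bra0_mul (H : IsInvAt f c z) (l j : Fin m) :
    ∑ i, bra0 (f l) (f i) z * c i j z = if l = j then 1 else 0 := by
  simpa [Matrix.mul_apply, Matrix.one_apply] using congrFun (congrFun H l) j

lemma IsInvAt.braD_casimir (H : IsInvAt f c z) (l : Fin m) (h : P n → ℝ) :
    braD f c (f l) h z = 0 := by
  have hsum : ∑ i, ∑ j, c i j z * bra0 (f i) (f l) z * bra0 (f j) h z =
      ∑ j, -(∑ i, bra0 (f l) (f i) z * c i j z) * bra0 (f j) h z := by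
    rw [Finset.sum_comm]
    refine Finset.sum_congr rfl fun j _ => ?_
    rw [← Finset.sum_neg_distrib, Finset.sum_mul]
    refine Finset.sum_congr rfl fun i _ => ?_
    rw [bra0_antisymm (f i) (f l)]
    ring
  simp only [braD, hsum, H.sum_bra0_mul]
  simp

lemma IsInvAt.braD_antisymm (H : IsInvAt f c z) (g h : P n → ℝ) :
    braD f c g h z = -braD f c h g z := by
  simp only [braD]
  rw [bra0_antisymm g h, neg_add, Finset.sum_comm]
  simp only [← Finset.sum_neg_distrib]
  congr 1
  refine Finset.sum_congr rfl fun i _ => Finset.sum_congr rfl fun j _ => ?_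
  rw [H.antisymm j i]
  ring

lemma IsInvAt.braD_add_sum_left (H : IsInvAt f c z) {g : P n → ℝ}
    (hg : DifferentiableAt ℝ g z) (hf : ∀ i, DifferentiableAt ℝ (f i) z)
    (a : Fin m → ℝ) (h : P n → ℝ) :
    braD f c (fun y => g y + ∑ i, a i * f i y) h z = braD f c g h z := by
  have expand : braD f c (fun y => g y + ∑ i, a i * f i y) h z =
      braD f c g h z + ∑ l, a l * braD f c (f l) h z := by
    simp only [braD, bra0_antisymm (f _) (fun y => g y + ∑ i, a i * f i y),
      bra0_add_sum_left hg hf, mul_add, Finset.sum_add_distrib]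
    have hsum : ∑ i, ∑ j, c i j z * -(bra0 g (f i) z + ∑ l, a l * bra0 (f l) (f i) z) *
          bra0 (f j) h z =
        ∑ i, ∑ j, c i j z * bra0 (f i) g z * bra0 (f j) h z +
          ∑ l, a l * ∑ i, ∑ j, c i j z * bra0 (f i) (f l) z * bra0 (f j) h z := by
      simp only [Finset.mul_sum]
      rw [Finset.sum_comm (s := Finset.univ (α := Fin m)) (t := Finset.univ)
        (f := fun l i => ∑ j, a l * (c i j z * bra0 (f i) (f l) z * bra0 (f j) h z)),
        ← Finset.sum_add_distrib]
      refine Finset.sum_congr rfl fun i _ => ?_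
      rw [Finset.sum_comm, ← Finset.sum_add_distrib]
      refine Finset.sum_congr rfl fun j _ => ?_
      rw [bra0_antisymm (f i) g, neg_add, ← Finset.sum_neg_distrib, mul_add, add_mul,
        Finset.mul_sum, Finset.sum_mul]
      congr 1
      refine Finset.sum_congr rfl fun l _ => ?_
      rw [bra0_antisymm (f i) (f l)]
      ring
    rw [hsum]
    ring
  simp [expand, H.braD_casimir]

lemma IsInvAt.braD_add_sum (H : IsInvAt f c z) {g h : P n → ℝ}
    (hg : DifferentiableAt ℝ g z) (hh : DifferentiableAt ℝ h z)
    (hf : ∀ i, DifferentiableAt ℝ (f i) z) (a b : Fin m → ℝ) :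
    braD f c (fun y => g y + ∑ i, a i * f i y) (fun y => h y + ∑ i, b i * f i y) z =
      braD f c g h z := by
  rw [H.braD_add_sum_left hg hf, H.braD_antisymm, H.braD_add_sum_left hh hf,
    ← H.braD_antisymm]

/-- A function can be made to commute with all `f j` at a given point by adding a constant
linear combination of the `f i`. -/
lemma IsInvAt.exists_bra0_eq_zero (H : IsInvAt f c z) {g : P n → ℝ}
    (hg : DifferentiableAt ℝ g z) (hf : ∀ i, DifferentiableAt ℝ (f i) z) :
    ∃ a : Fin m → ℝ, ∀ j, bra0 (f j) (fun y => g y + ∑ i, a i * f i y) z = 0 := by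
  refine ⟨fun i => -∑ l, c i l z * bra0 (f l) g z, fun j => ?_⟩
  rw [bra0_antisymm, bra0_add_sum_left hg hf]
  have hsum : ∑ i, (-∑ l, c i l z * bra0 (f l) g z) * bra0 (f i) (f j) z =
      ∑ l, (∑ i, bra0 (f j) (f i) z * c i l z) * bra0 (f l) g z := by
    simp only [← Finset.sum_neg_distrib, Finset.sum_mul]
    rw [Finset.sum_comm]
    refine Finset.sum_congr rfl fun l _ => Finset.sum_congr rfl fun i _ => ?_
    rw [bra0_antisymm (f i) (f j)]
    ring
  rw [hsum]
  simp [H.sum_bra0_mul, bra0_antisymm (f j) g]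

end Inverse

/-- Where `g`, `h`, `k` commute with all `f i`, the double Dirac bracket is the canonical one. -/
lemma braD_braD_eq_bra0_bra0 {n m : ℕ} {f : Fin m → P n → ℝ} {c : Fin m → Fin m → P n → ℝ}
    {g h k : P n → ℝ} {z : P n} (hf : ∀ i, ContDiffAt ℝ 2 (f i) z)
    (hc : ∀ i j, DifferentiableAt ℝ (c i j) z)
    (hh : ContDiffAt ℝ 2 h z) (hk : ContDiffAt ℝ 2 k z)
    (hg0 : ∀ i, bra0 (f i) g z = 0) (hh0 : ∀ i, bra0 (f i) h z = 0)
    (hk0 : ∀ i, bra0 (f i) k z = 0) :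
    braD f c g (braD f c h k) z = bra0 g (bra0 h k) z := by
  have hterm (i j : Fin m) : HasFDerivAt
      (fun y => c i j y * bra0 (f i) h y * bra0 (f j) k y) (0 : P n →L[ℝ] ℝ) z := by
    refine (((hc i j).hasFDerivAt.mul (hasFDerivAt_bra0 (hf i) hh)).mul
      (hasFDerivAt_bra0 (hf j) hk)).congr_fderiv ?_
    simp [hh0, hk0]
  have hderiv : fderiv ℝ (braD f c h k) z = fderiv ℝ (bra0 h k) z := by
    have := (hasFDerivAt_bra0 hh hk).add (HasFDerivAt.fun_sum (u := Finset.univ) fun i _ =>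
      HasFDerivAt.fun_sum (u := Finset.univ) fun j _ => hterm i j)
    simp only [Finset.sum_const_zero, add_zero] at this
    exact this.fderiv.trans (hasFDerivAt_bra0 hh hk).fderiv.symm
  rw [braD]
  simp [hg0, bra0_eq_fderiv_hamVec g, hderiv]

theorem dirac_bracket_jacobi_and_casimirs
    (n k : ℕ) (hk1 : 1 ≤ k) (hk2 : k ≤ n - 1) (hn : 1 ≤ n)
    (W : Set (P n)) (hW : IsOpen W)
    (f : Fin (2 * (n - k)) → P n → ℝ)
    (hf : ∀ i, ContDiffOn ℝ (⊤ : ℕ∞) (f i) W)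
    (c : Fin (2 * (n - k)) → Fin (2 * (n - k)) → P n → ℝ)
    (hc : ∀ i j, ContDiffOn ℝ (⊤ : ℕ∞) (c i j) W)
    (hinv : ∀ x ∈ W,
      (Matrix.of fun i j => bra0 (f i) (f j) x) * (Matrix.of fun i j => c i j x) = 1) :
    (∀ g h k' : P n → ℝ,
        ContDiffOn ℝ (⊤ : ℕ∞) g W → ContDiffOn ℝ (⊤ : ℕ∞) h W →
        ContDiffOn ℝ (⊤ : ℕ∞) k' W →
        ∀ x ∈ W,
          braD f c g (braD f c h k') x + braD f c h (braD f c k' g) x +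
            braD f c k' (braD f c g h) x = 0) ∧
    (∀ l : Fin (2 * (n - k)), ∀ h : P n → ℝ, ContDiffOn ℝ (⊤ : ℕ∞) h W →
        ∀ x ∈ W, braD f c (f l) h x = 0) := by
  have cd {u : P n → ℝ} (hu : ContDiffOn ℝ (⊤ : ℕ∞) u W) {y : P n} (hy : y ∈ W) :
      ContDiffAt ℝ 2 u y :=
    (hu.contDiffAt (hW.mem_nhds hy)).of_le (WithTop.coe_le_coe.2 (le_top : (2 : ℕ∞) ≤ ⊤))
  have da {u : P n → ℝ} (hu : ContDiffOn ℝ (⊤ : ℕ∞) u W) {y : P n} (hy : y ∈ W) :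
      DifferentiableAt ℝ u y := (cd hu hy).differentiableAt (by norm_num)
  have inv (y : P n) (hy : y ∈ W) : IsInvAt f c y := hinv y hy
  refine ⟨fun g h k' hg hh hk x hx => ?_, fun l h _ x hx => (inv x hx).braD_casimir l h⟩
  have hfx (i) := da (hf i) hx
  obtain ⟨a, ha⟩ := (inv x hx).exists_bra0_eq_zero (da hg hx) hfx
  obtain ⟨b, hb⟩ := (inv x hx).exists_bra0_eq_zero (da hh hx) hfx
  obtain ⟨d, hd⟩ := (inv x hx).exists_bra0_eq_zero (da hk hx) hfx
  have smooth {u : P n → ℝ} (hu : ContDiffOn ℝ (⊤ : ℕ∞) u W) (e : Fin (2 * (n - k)) → ℝ) :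
      ContDiffAt ℝ 2 (fun y => u y + ∑ i, e i * f i y) x :=
    (cd hu hx).add (ContDiffAt.sum fun i _ => contDiffAt_const.mul (cd (hf i) hx))
  have double {u v w : P n → ℝ} (hu : ContDiffOn ℝ (⊤ : ℕ∞) u W)
      (hv : ContDiffOn ℝ (⊤ : ℕ∞) v W) (hw : ContDiffOn ℝ (⊤ : ℕ∞) w W)
      {p q r : Fin (2 * (n - k)) → ℝ}
      (hp : ∀ j, bra0 (f j) (fun y => u y + ∑ i, p i * f i y) x = 0)
      (hq : ∀ j, bra0 (f j) (fun y => v y + ∑ i, q i * f i y) x = 0)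
      (hr : ∀ j, bra0 (f j) (fun y => w y + ∑ i, r i * f i y) x = 0) :
      braD f c u (braD f c v w) x =
        bra0 (fun y => u y + ∑ i, p i * f i y)
          (bra0 (fun y => v y + ∑ i, q i * f i y) (fun y => w y + ∑ i, r i * f i y)) x := by
    rw [← braD_braD_eq_bra0_bra0 (c := c) (fun i => cd (hf i) hx) (fun i j => da (hc i j) hx)
      (smooth hv q) (smooth hw r) hp hq hr, (inv x hx).braD_add_sum_left (da hu hx) hfx]
    refine braD_congr_right f c u ?_
    filter_upwards [hW.mem_nhds hx] with y hy
    exact ((inv y hy).braD_add_sum (da hv hy) (da hw hy) (fun i => da (hf i) hy) q r).symm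
  rw [double hg hh hk ha hb hd, double hh hk hg hb hd ha, double hk hg hh hd ha hb]
  exact bra0_jacobi (smooth hg a) (smooth hh b) (smooth hk d)

end
end Damianou13
end

section
/- Fix 1 ≤ k ≤ n − 1 and smooth functions ζ^i_s (i = 1,…,n−k, s = 1,…,n) of the variable q on ℝ^n, and a smooth Hamiltonian H on ℝ^{2n}. Set f^i = Σ_s ζ^i_s ∂H/∂p_s, let Z^i be the vector field Σ_s ζ^i_s ∂/∂p_s, and let C^{ij} = Σ_{s,t} ζ^i_s (∂²H/∂p_s∂p_t) ζ^j_t; assume the matrix (C^{ij}) is invertible at every point of an open set W ⊆ ℝ^{2n}, with inverse entries C_{ij}. Define the bivector field Λ_nh = Λ₀ + Σ_{l,m} C_{lm} X_{f^l}∧Z^m + ½ Σ_{i,j,l,m} C_{ij}{f^j,f^l}₀ C_{lm} Z^i∧Z^m on W, where Λ₀ is the canonical bivector field and X_{f^l} its Hamiltonian vector fields. Then at every point of W: Λ_nh(df^s, dh) = 0 for every s = 1,…,n−k and every smooth function h, and Λ_nh(ζ^s, dh) = 0 for every s = 1,…,n−k and every smooth h, where ζ^s denotes the 1-form Σ_t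 ζ^s_t dq_t. -/
/-!
STATEMENT 14.  For the nonholonomic bivector field
`Λ_nh = Λ₀ + Σ C_{lm} X_{f^l} ∧ Z^m + ½ Σ C_{ij}{f^j,f^l}₀ C_{lm} Z^i ∧ Z^m`,
one has `Λ_nh(df^s, dh) = 0` and `Λ_nh(ζ^s, dh) = 0` on `W`, for every
`s = 1,…,n-k` and every smooth `h`.
-/

namespace Damianou14

noncomputable section

/-- Phase space `ℝ^{2n}` with coordinates `(q,p)`. -/
abbrev P (n : ℕ) := (Fin n → ℝ) × (Fin n → ℝ)

/-- Covectors, given by their `dq`- and `dp`-components. -/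
abbrev Cov (n : ℕ) := (Fin n → ℝ) × (Fin n → ℝ)

/-- Vectors, given by their `∂/∂q`- and `∂/∂p`-components. -/
abbrev Vec (n : ℕ) := (Fin n → ℝ) × (Fin n → ℝ)

def pdq {n : ℕ} (g : P n → ℝ) (s : Fin n) (z : P n) : ℝ :=
  fderiv ℝ g z (Pi.single s 1, 0)

def pdp {n : ℕ} (g : P n → ℝ) (s : Fin n) (z : P n) : ℝ :=
  fderiv ℝ g z (0, Pi.single s 1)

/-- The canonical Poisson bracket. -/
def bra0 {n : ℕ} (g h : P n → ℝ) : P n → ℝ :=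
  fun z => ∑ s, (pdq g s z * pdp h s z - pdp g s z * pdq h s z)

/-- The differential of a function, as a covector. -/
def dcov {n : ℕ} (h : P n → ℝ) (z : P n) : Cov n :=
  (fun s => pdq h s z, fun s => pdp h s z)

/-- Evaluation of a covector on a vector. -/
def ev {n : ℕ} (α : Cov n) (X : Vec n) : ℝ := ∑ s, (α.1 s * X.1 s + α.2 s * X.2 s)

/-- The canonical bivector field `Λ₀`, with `Λ₀(dg,dh) = {g,h}₀`. -/
def Lam0 {n : ℕ} (α β : Cov n) : ℝ := ∑ s, (α.1 s * β.2 s - α.2 s * β.1 s)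

/-- The Hamiltonian vector field `X_f` (so that `X_f(h) = {f,h}₀`). -/
def Xham {n : ℕ} (f : P n → ℝ) (z : P n) : Vec n :=
  (fun s => -pdp f s z, fun s => pdq f s z)

/-- `(X ∧ Y)(α,β) = α(X)β(Y) - β(X)α(Y)`. -/
def wedgeV {n : ℕ} (X Y : Vec n) (α β : Cov n) : ℝ :=
  ev α X * ev β Y - ev β X * ev α Y

open Matrix in
theorem sum_bivector_linear {ι : Type*} [Fintype ι] (A : Matrix ι ι ℝ) (x y a b : ι → ℝ) :
    ∑ l, ∑ m, A l m * (x l * b m - y l * a m) = x ⬝ᵥ A *ᵥ b - y ⬝ᵥ A *ᵥ a := by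
  simp only [dotProduct, mulVec, Finset.mul_sum, ← Finset.sum_sub_distrib]
  refine Finset.sum_congr rfl fun l _ => Finset.sum_congr rfl fun m _ => ?_
  ring

open Matrix in
theorem sum_bivector_quadratic {ι : Type*} [Fintype ι] (A B : Matrix ι ι ℝ) (a b : ι → ℝ) :
    ∑ i, ∑ j, ∑ l, ∑ m, A i j * B j l * A l m * (a i * b m - b i * a m) =
      a ⬝ᵥ A *ᵥ B *ᵥ A *ᵥ b - b ⬝ᵥ A *ᵥ B *ᵥ A *ᵥ a := by
  simp only [dotProduct, mulVec, Finset.mul_sum, ← Finset.sum_sub_distrib]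
  refine Finset.sum_congr rfl fun i _ => Finset.sum_congr rfl fun j _ =>
    Finset.sum_congr rfl fun l _ => Finset.sum_congr rfl fun m _ => ?_
  ring

open Matrix in
theorem mulVec_row_of_mul_eq_one {ι : Type*} [Fintype ι] [DecidableEq ι] {C A : Matrix ι ι ℝ}
    (hC : C.IsSymm) (h : C * A = 1) (s : ι) : A *ᵥ C s = Pi.single s 1 := by
  have hs : C s = C *ᵥ Pi.single s 1 := by
    ext t; simp [hC.apply]
  rw [hs, mulVec_mulVec, mul_eq_one_comm.mp h, one_mulVec]

open Matrix in
theorem dotProduct_mulVec_comm_of_isSymm {ι : Type*} [Fintype ι] {A : Matrix ι ι ℝ}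
    (hA : A.IsSymm) (x y : ι → ℝ) : x ⬝ᵥ A *ᵥ y = y ⬝ᵥ A *ᵥ x := by
  rw [dotProduct_mulVec, ← mulVec_transpose, hA.eq, dotProduct_comm]

open Matrix in
theorem isSymm_of_mul_eq_one {ι : Type*} [Fintype ι] [DecidableEq ι] {C A : Matrix ι ι ℝ}
    (hC : C.IsSymm) (h : C * A = 1) : A.IsSymm := by
  rw [← inv_eq_right_inv h]
  exact hC.inv

theorem bra0_antisymm {n : ℕ} (g h : P n → ℝ) (z : P n) : bra0 g h z = -bra0 h g z := by
  simp only [bra0, ← Finset.sum_neg_distrib]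
  exact Finset.sum_congr rfl fun s _ => by ring

theorem ev_dcov_Xham {n : ℕ} (f h : P n → ℝ) (z : P n) :
    ev (dcov h z) (Xham f z) = bra0 f h z := by
  simp only [ev, dcov, Xham, bra0]
  exact Finset.sum_congr rfl fun s _ => by ring

theorem Lam0_dcov {n : ℕ} (f h : P n → ℝ) (z : P n) :
    Lam0 (dcov f z) (dcov h z) = bra0 f h z := rfl

theorem fderiv_pdp {n : ℕ} {H : P n → ℝ} (hH : ContDiff ℝ (⊤ : ℕ∞) H) (t : Fin n) (z v : P n) :
    fderiv ℝ (fun w => pdp H t w) z v = fderiv ℝ (fderiv ℝ H) z v (0, Pi.single t 1) := by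
  have hd : DifferentiableAt ℝ (fderiv ℝ H) z :=
    (hH.fderiv_right (m := 1) (by norm_cast)).differentiable one_ne_zero z
  simp only [pdp]
  rw [fderiv_clm_apply hd (differentiableAt_const _)]
  simp

theorem differentiable_pdp {n : ℕ} {H : P n → ℝ} (hH : ContDiff ℝ (⊤ : ℕ∞) H) (t : Fin n) :
    Differentiable ℝ (fun w => pdp H t w) := by
  have hd : Differentiable ℝ (fderiv ℝ H) :=
    (hH.fderiv_right (m := 1) (by norm_cast)).differentiable one_ne_zero
  exact fun z => (hd z).clm_apply (differentiableAt_const _)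

theorem fderiv_pdp_symm {n : ℕ} {H : P n → ℝ} (hH : ContDiff ℝ (⊤ : ℕ∞) H) (s t : Fin n)
    (z : P n) :
    fderiv ℝ (fun w => pdp H t w) z (0, Pi.single s 1) =
      fderiv ℝ (fun w => pdp H s w) z (0, Pi.single t 1) := by
  rw [fderiv_pdp hH, fderiv_pdp hH]
  exact (hH.contDiffAt.isSymmSndFDerivAt (by simp; norm_cast)) _ _

theorem pdp_sum_mul_pdp {n : ℕ} {H : P n → ℝ} (hH : ContDiff ℝ (⊤ : ℕ∞) H)
    {ζ : Fin n → (Fin n → ℝ) → ℝ} (hζ : ∀ s, Differentiable ℝ (ζ s)) (t : Fin n) (z : P n) :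
    pdp (fun w => ∑ s, ζ s w.1 * pdp H s w) t z =
      ∑ s, ζ s z.1 * fderiv ℝ (fun w => pdp H s w) z (0, Pi.single t 1) := by
  have hfst (s : Fin n) : HasFDerivAt (fun w : P n => ζ s w.1)
      ((fderiv ℝ (ζ s) z.1).comp (ContinuousLinearMap.fst ℝ _ _)) z :=
    (hζ s z.1).hasFDerivAt.comp z hasFDerivAt_fst
  have hsum := HasFDerivAt.fun_sum (u := Finset.univ) fun s _ =>
    (hfst s).fun_mul (differentiable_pdp hH s z).hasFDerivAt
  rw [pdp, hsum.fderiv]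
  simp

open Matrix in
theorem nonholonomic_bivector_kernel
    (n k : ℕ) (hk1 : 1 ≤ k) (hk2 : k ≤ n - 1) (hn : 1 ≤ n)
    (ζ : Fin (n - k) → Fin n → (Fin n → ℝ) → ℝ)
    (hζ : ∀ i s, ContDiff ℝ (⊤ : ℕ∞) (ζ i s))
    (H : P n → ℝ) (hH : ContDiff ℝ (⊤ : ℕ∞) H)
    -- the constraints fⁱ = Σ_s ζⁱ_s ∂H/∂p_s
    (f : Fin (n - k) → P n → ℝ)
    (hfdef : ∀ i z, f i z = ∑ s, ζ i s z.1 * pdp H s z)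
    -- the vector fields Zⁱ = Σ_s ζⁱ_s ∂/∂p_s
    (Z : Fin (n - k) → P n → Vec n)
    (hZdef : ∀ i z, Z i z = (0, fun s => ζ i s z.1))
    -- the matrix C^{ij} = Σ_{s,t} ζⁱ_s (∂²H/∂p_s∂p_t) ζʲ_t
    (C : Fin (n - k) → Fin (n - k) → P n → ℝ)
    (hCdef : ∀ i j z, C i j z =
      ∑ s, ∑ t, ζ i s z.1 * fderiv ℝ (fun w => pdp H t w) z (0, Pi.single s 1) * ζ j t z.1)
    -- invertibility on W, with inverse entries Cinv
    (W : Set (P n)) (hW : IsOpen W)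
    (Cinv : Fin (n - k) → Fin (n - k) → P n → ℝ)
    (hCinv : ∀ z ∈ W,
      (Matrix.of fun i j => C i j z) * (Matrix.of fun i j => Cinv i j z) = 1)
    -- the bivector field Λ_nh
    (Lnh : P n → Cov n → Cov n → ℝ)
    (hLdef : ∀ z α β, Lnh z α β =
      Lam0 α β + (∑ l, ∑ m, Cinv l m z * wedgeV (Xham (f l) z) (Z m z) α β) +
      (1 / 2) * ∑ i, ∑ j, ∑ l, ∑ m,
        Cinv i j z * bra0 (f j) (f l) z * Cinv l m z * wedgeV (Z i z) (Z m z) α β) :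
    ∀ z ∈ W, ∀ s : Fin (n - k), ∀ h : P n → ℝ, ContDiff ℝ (⊤ : ℕ∞) h →
      Lnh z (dcov (f s) z) (dcov h z) = 0 ∧
      Lnh z ((fun t => ζ s t z.1, 0) : Cov n) (dcov h z) = 0 := by
  intro z hz s h _
  have hf (i : Fin (n - k)) : f i = fun w => ∑ s, ζ i s w.1 * pdp H s w := funext (hfdef i)
  have hpf (i : Fin (n - k)) (t : Fin n) : pdp (f i) t z =
      ∑ u, ζ i u z.1 * fderiv ℝ (fun w => pdp H u w) z (0, Pi.single t 1) := by
    rw [hf i]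
    exact pdp_sum_mul_pdp hH (fun s => (hζ i s).differentiable (by simp)) t z
  have hpfZ (i j : Fin (n - k)) : ∑ t, pdp (f i) t z * ζ j t z.1 = C i j z := by
    rw [hCdef, Finset.sum_comm]
    refine Finset.sum_congr rfl fun t _ => ?_
    rw [hpf, Finset.sum_mul]
    exact Finset.sum_congr rfl fun u _ => by rw [fderiv_pdp_symm hH t u]
  set D : Matrix (Fin (n - k)) (Fin (n - k)) ℝ := Matrix.of fun i j => C i j z with hD
  set A : Matrix (Fin (n - k)) (Fin (n - k)) ℝ := Matrix.of fun i j => Cinv i j z with hA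
  set B : Matrix (Fin (n - k)) (Fin (n - k)) ℝ := Matrix.of fun i j => bra0 (f i) (f j) z with hB
  have hDA : D * A = 1 := hCinv z hz
  have hDsymm : D.IsSymm := by
    refine Matrix.IsSymm.ext fun i j => ?_
    simp only [hD, Matrix.of_apply, hCdef]
    rw [Finset.sum_comm]
    refine Finset.sum_congr rfl fun t _ => Finset.sum_congr rfl fun u _ => ?_
    rw [fderiv_pdp_symm hH u t]
    ring
  have hAsymm := isSymm_of_mul_eq_one hDsymm hDA
  have hAD := mulVec_row_of_mul_eq_one hDsymm hDA s
  have key (α β : Cov n) : Lnh z α β = Lam0 α β +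
      ((fun l => ev α (Xham (f l) z)) ⬝ᵥ A *ᵥ (fun m => ev β (Z m z)) -
        (fun l => ev β (Xham (f l) z)) ⬝ᵥ A *ᵥ (fun m => ev α (Z m z))) +
      (1 / 2) * ((fun m => ev α (Z m z)) ⬝ᵥ A *ᵥ B *ᵥ A *ᵥ (fun m => ev β (Z m z)) -
        (fun m => ev β (Z m z)) ⬝ᵥ A *ᵥ B *ᵥ A *ᵥ (fun m => ev α (Z m z))) := by
    rw [hLdef, ← sum_bivector_linear, ← sum_bivector_quadratic]
    rfl
  constructor
  · have hfZ : (fun m => ev (dcov (f s) z) (Z m z)) = D s := by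
      funext m
      simp [hD, ← hpfZ, ev, dcov, hZdef]
    have hBs : (fun l => bra0 (f l) (f s) z) = -B s := by
      funext l
      simp [hB, bra0_antisymm (f l)]
    have hBe : B *ᵥ Pi.single s 1 = -B s := by
      rw [← hBs]
      ext l
      simp [hB]
    rw [key, hfZ, hAD, hBe, dotProduct_mulVec_comm_of_isSymm hAsymm (D s), hAD,
      dotProduct_mulVec_comm_of_isSymm hAsymm _ (-B s), Lam0_dcov]
    simp only [ev_dcov_Xham]
    rw [hBs]
    simp only [dotProduct_single, mul_one, neg_dotProduct, mulVec]
    ring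
  · have hζZ : (fun m => ev ((fun t => ζ s t z.1, 0) : Cov n) (Z m z)) = 0 := by
      funext m
      simp [ev, hZdef]
    have hζX : (fun l => ev ((fun t => ζ s t z.1, 0) : Cov n) (Xham (f l) z)) = -D s := by
      funext l
      rw [Pi.neg_apply, ← hDsymm.apply]
      simp [hD, ← hpfZ, ev, Xham, mul_comm]
    have hζL : Lam0 ((fun t => ζ s t z.1, 0) : Cov n) (dcov h z) = ev (dcov h z) (Z s z) := by
      simp [Lam0, ev, hZdef, mul_comm]
    rw [key, hζZ, hζX, hζL, neg_dotProduct, dotProduct_mulVec_comm_of_isSymm hAsymm (D s), hAD]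
    simp

end
end Damianou14
end

section
/- Let n ≥ 2. On ℝ^{2n} with coordinates (a₁,…,a_n,b₁,…,b_n) and cyclic convention b_{n+1} = b₁, define the Toda bracket {g,h}_T = Σ_{i=1}^{n} a_i [ ∂g/∂a_i (∂h/∂b_i − ∂h/∂b_{i+1}) − ∂h/∂a_i (∂g/∂b_i − ∂g/∂b_{i+1}) ]. Then {·,·}_T satisfies the Jacobi identity for all smooth functions, the functions C₁ = b₁ + b₂ + ⋯ + b_n and C₂ = a₁a₂⋯a_n are Casimirs ({C₁,h}_T = {C₂,h}_T = 0 for every smooth h), and the associated antisymmetric coefficient matrix has rank 2n−2 at every point of the set U = {(a,b) ∈ ℝ^{2n} : Σ_{i=1}^{n} a₁⋯a_{i−1}a_{i+1}⋯a_n ≠ 0}. -/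
/-!
STATEMENT 15.  The periodic Toda bracket on `ℝ^{2n}` (Flaschka coordinates
`(a,b)`, cyclic convention `b_{n+1} = b₁`) satisfies the Jacobi identity,
admits `C₁ = Σ b_i` and `C₂ = Π a_i` as Casimirs, and its coefficient matrix
has rank `2n-2` at every point of `U = {Σ_i a₁⋯â_i⋯a_n ≠ 0}`.
-/

namespace Damianou15

noncomputable section

/-- `ℝ^{2n}` with coordinates `(a₁,…,a_n,b₁,…,b_n)`. -/
abbrev P (n : ℕ) := (Fin n → ℝ) × (Fin n → ℝ)

/-- Cyclic successor on `Fin n`. -/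
def cyc {n : ℕ} (i : Fin n) : Fin n :=
  if h : (i : ℕ) + 1 < n then ⟨(i : ℕ) + 1, h⟩ else ⟨0, by have := i.isLt; omega⟩

def pa {n : ℕ} (g : P n → ℝ) (i : Fin n) (z : P n) : ℝ :=
  fderiv ℝ g z (Pi.single i 1, 0)

def pb {n : ℕ} (g : P n → ℝ) (i : Fin n) (z : P n) : ℝ :=
  fderiv ℝ g z (0, Pi.single i 1)

/-- The periodic Toda bracket. -/
def braT {n : ℕ} (g h : P n → ℝ) : P n → ℝ :=
  fun z => ∑ i, z.1 i *
    (pa g i z * (pb h i z - pb h (cyc i) z) - pa h i z * (pb g i z - pb g (cyc i) z))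

/-- The coordinate functions, indexed by `Fin n ⊕ Fin n`. -/
def coord {n : ℕ} : Fin n ⊕ Fin n → P n → ℝ :=
  Sum.elim (fun i z => z.1 i) (fun i z => z.2 i)

/-- The coordinate direction `∂/∂a_i`. -/
def dirA {n : ℕ} (i : Fin n) : P n := (Pi.single i 1, 0)

/-- The direction `∂/∂b_i - ∂/∂b_{i+1}`. -/
def dirB {n : ℕ} (i : Fin n) : P n := (0, Pi.single i 1 - Pi.single (cyc i) 1)

lemma fderiv_dirB {n : ℕ} (f : P n → ℝ) (z : P n) (i : Fin n) :
    fderiv ℝ f z (dirB i) = pb f i z - pb f (cyc i) z := by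
  rw [pb, pb, ← map_sub]
  simp [dirB]

lemma braT_eq_sum_dir {n : ℕ} (g h : P n → ℝ) :
    braT g h = fun z => ∑ i, z.1 i *
      (fderiv ℝ g z (dirA i) * fderiv ℝ h z (dirB i)
        - fderiv ℝ h z (dirA i) * fderiv ℝ g z (dirB i)) := by
  funext z
  simp only [braT, fderiv_dirB]
  rfl

lemma hasFDerivAt_fderiv_apply {E : Type*} [NormedAddCommGroup E] [NormedSpace ℝ E] {f : E → ℝ}
    (hf : ContDiff ℝ (⊤ : ℕ∞) f) (v z : E) :
    HasFDerivAt (fun y => fderiv ℝ f y v) ((fderiv ℝ (fderiv ℝ f) z).flip v) z := by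
  have h : DifferentiableAt ℝ (fderiv ℝ f) z :=
    ((hf.fderiv_right (m := 1) (by norm_cast)).differentiable (by norm_num)) z
  simpa using h.hasFDerivAt.clm_apply (hasFDerivAt_const v z)

lemma fderiv_fderiv_comm {E : Type*} [NormedAddCommGroup E] [NormedSpace ℝ E] {f : E → ℝ}
    (hf : ContDiff ℝ (⊤ : ℕ∞) f) (z u v : E) :
    fderiv ℝ (fderiv ℝ f) z u v = fderiv ℝ (fderiv ℝ f) z v u :=
  (hf.contDiffAt.isSymmSndFDerivAt (by simp; norm_cast)) u v

lemma fderiv_braT {n : ℕ} {g h : P n → ℝ} (hg : ContDiff ℝ (⊤ : ℕ∞) g)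
    (hh : ContDiff ℝ (⊤ : ℕ∞) h) (z w : P n) :
    fderiv ℝ (braT g h) z w =
      ∑ i, (w.1 i * (fderiv ℝ g z (dirA i) * fderiv ℝ h z (dirB i)
          - fderiv ℝ h z (dirA i) * fderiv ℝ g z (dirB i))
        + z.1 i *
          (fderiv ℝ (fderiv ℝ g) z w (dirA i) * fderiv ℝ h z (dirB i)
            + fderiv ℝ g z (dirA i) * fderiv ℝ (fderiv ℝ h) z w (dirB i)
            - fderiv ℝ (fderiv ℝ h) z w (dirA i) * fderiv ℝ g z (dirB i)
            - fderiv ℝ h z (dirA i) * fderiv ℝ (fderiv ℝ g) z w (dirB i))) := by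
  have hz : ∀ i, HasFDerivAt (fun y : P n => y.1 i)
      ((ContinuousLinearMap.proj i).comp (ContinuousLinearMap.fst ℝ (Fin n → ℝ) (Fin n → ℝ))) z :=
    fun i => ContinuousLinearMap.hasFDerivAt
      ((ContinuousLinearMap.proj i).comp (ContinuousLinearMap.fst ℝ (Fin n → ℝ) (Fin n → ℝ)))
  have key := HasFDerivAt.fun_sum (u := Finset.univ) fun i _ => (hz i).mul
    (((hasFDerivAt_fderiv_apply hg (dirA i) z).mul (hasFDerivAt_fderiv_apply hh (dirB i) z)).sub
      ((hasFDerivAt_fderiv_apply hh (dirA i) z).mul (hasFDerivAt_fderiv_apply hg (dirB i) z)))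
  rw [braT_eq_sum_dir]
  erw [key.fderiv]
  rw [sum_apply]
  refine Finset.sum_congr rfl fun i _ => ?_
  simp
  ring

lemma sum_sum_eq_zero_of_add_swap {ι : Type*} [Fintype ι] (F : ι → ι → ℝ)
    (hF : ∀ i j, F i j + F j i = 0) : ∑ i, ∑ j, F i j = 0 := by
  have h : ∑ i, ∑ j, F i j + ∑ i, ∑ j, F j i = 0 := by
    simp [← Finset.sum_add_distrib, hF]
  rw [Finset.sum_comm (f := fun i j => F j i)] at h
  linarith

lemma braT_braT {n : ℕ} {g h k : P n → ℝ}
    (hh : ContDiff ℝ (⊤ : ℕ∞) h) (hk : ContDiff ℝ (⊤ : ℕ∞) k) (z : P n) :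
    braT g (braT h k) z =
      (∑ j, ∑ i, z.1 j * z.1 i *
        (fderiv ℝ g z (dirA j) *
          (fderiv ℝ (fderiv ℝ h) z (dirB j) (dirA i) * fderiv ℝ k z (dirB i)
            + fderiv ℝ h z (dirA i) * fderiv ℝ (fderiv ℝ k) z (dirB j) (dirB i)
            - fderiv ℝ (fderiv ℝ k) z (dirB j) (dirA i) * fderiv ℝ h z (dirB i)
            - fderiv ℝ k z (dirA i) * fderiv ℝ (fderiv ℝ h) z (dirB j) (dirB i))
        - fderiv ℝ g z (dirB j) *
          (fderiv ℝ (fderiv ℝ h) z (dirA j) (dirA i) * fderiv ℝ k z (dirB i)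
            + fderiv ℝ h z (dirA i) * fderiv ℝ (fderiv ℝ k) z (dirA j) (dirB i)
            - fderiv ℝ (fderiv ℝ k) z (dirA j) (dirA i) * fderiv ℝ h z (dirB i)
            - fderiv ℝ k z (dirA i) * fderiv ℝ (fderiv ℝ h) z (dirA j) (dirB i))))
      - ∑ j, z.1 j * fderiv ℝ g z (dirB j) *
          (fderiv ℝ h z (dirA j) * fderiv ℝ k z (dirB j)
            - fderiv ℝ k z (dirA j) * fderiv ℝ h z (dirB j)) := by
  conv_lhs => rw [braT_eq_sum_dir]
  rw [← Finset.sum_sub_distrib]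
  refine Finset.sum_congr rfl fun j _ => ?_
  rw [fderiv_braT hh hk, fderiv_braT hh hk, Finset.sum_add_distrib (f := fun i => (dirA j).1 i * _)]
  have h1 : ∀ c : Fin n → ℝ, ∑ i, (dirA j).1 i * c i = c j := by
    intro c
    simp [dirA, Pi.single_apply]
  have h2 : ∀ i, (dirB j).1 i = 0 := fun i => rfl
  simp only [h1, h2, zero_mul, zero_add]
  simp only [mul_sub, mul_add, sub_mul, add_mul, Finset.mul_sum, Finset.sum_mul,
    Finset.sum_sub_distrib, Finset.sum_add_distrib]
  simp only [mul_assoc, mul_left_comm, mul_comm]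
  ring

lemma braT_jacobi {n : ℕ} {g h k : P n → ℝ} (hg : ContDiff ℝ (⊤ : ℕ∞) g)
    (hh : ContDiff ℝ (⊤ : ℕ∞) h) (hk : ContDiff ℝ (⊤ : ℕ∞) k) (z : P n) :
    braT g (braT h k) z + braT h (braT k g) z + braT k (braT g h) z = 0 := by
  rw [braT_braT hh hk, braT_braT hk hg, braT_braT hg hh]
  have rearrange : ∀ a b c d e f : ℝ, a + c + e = 0 → b + d + f = 0 →
      a - b + (c - d) + (e - f) = 0 := by intros; linarith
  apply rearrange
  · simp only [← Finset.sum_add_distrib]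
    refine sum_sum_eq_zero_of_add_swap _ fun i j => ?_
    rw [fderiv_fderiv_comm hg z (dirB i) (dirA j), fderiv_fderiv_comm hg z (dirB j) (dirA i),
      fderiv_fderiv_comm hg z (dirA i) (dirA j), fderiv_fderiv_comm hg z (dirB i) (dirB j),
      fderiv_fderiv_comm hh z (dirB i) (dirA j), fderiv_fderiv_comm hh z (dirB j) (dirA i),
      fderiv_fderiv_comm hh z (dirA i) (dirA j), fderiv_fderiv_comm hh z (dirB i) (dirB j),
      fderiv_fderiv_comm hk z (dirB i) (dirA j), fderiv_fderiv_comm hk z (dirB j) (dirA i),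
      fderiv_fderiv_comm hk z (dirA i) (dirA j), fderiv_fderiv_comm hk z (dirB i) (dirB j)]
    ring
  · simp only [← Finset.sum_add_distrib]
    exact Finset.sum_eq_zero fun i _ => by ring

lemma cyc_injective {n : ℕ} : Function.Injective (cyc : Fin n → Fin n) := by
  intro i j hij
  simp only [cyc] at hij
  split_ifs at hij <;> simp only [Fin.mk.injEq] at hij <;> ext <;> omega

lemma sum_sub_cyc {n : ℕ} (y : Fin n → ℝ) : ∑ i, (y i - y (cyc i)) = 0 := by
  rw [Finset.sum_sub_distrib, sub_eq_zero]
  exact (Function.Bijective.sum_comp (Finite.injective_iff_bijective.mp cyc_injective) y).symm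

lemma fderiv_coord {n : ℕ} (u : Fin n ⊕ Fin n) (z w : P n) :
    fderiv ℝ (coord u) z w = coord u w := by
  cases u with
  | inl i =>
    exact congrArg (· w) (ContinuousLinearMap.fderiv
      ((ContinuousLinearMap.proj i).comp (ContinuousLinearMap.fst ℝ (Fin n → ℝ) (Fin n → ℝ)))
      (x := z))
  | inr i =>
    exact congrArg (· w) (ContinuousLinearMap.fderiv
      ((ContinuousLinearMap.proj i).comp (ContinuousLinearMap.snd ℝ (Fin n → ℝ) (Fin n → ℝ)))
      (x := z))

lemma differentiableAt_coord {n : ℕ} (u : Fin n ⊕ Fin n) (z : P n) :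
    DifferentiableAt ℝ (coord u) z := by
  cases u <;> simp only [coord, Sum.elim_inl, Sum.elim_inr] <;> fun_prop

lemma braT_sum_b {n : ℕ} (h : P n → ℝ) (z : P n) : braT (fun w => ∑ i, w.2 i) h z = 0 := by
  have hd : ∀ w, fderiv ℝ (fun w : P n => ∑ i, w.2 i) z w = ∑ i, w.2 i := by
    intro w
    have := fderiv_fun_sum (u := Finset.univ) (x := z) (𝕜 := ℝ)
      fun (i : Fin n) _ => differentiableAt_coord (Sum.inr i) z
    erw [this]
    rw [sum_apply]
    exact Finset.sum_congr rfl fun i _ => fderiv_coord (Sum.inr i) z w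
  rw [braT_eq_sum_dir]
  simp only [hd]
  refine Finset.sum_eq_zero fun i _ => ?_
  simp [dirA, dirB]

lemma braT_prod_a {n : ℕ} (h : P n → ℝ) (z : P n) : braT (fun w => ∏ i, w.1 i) h z = 0 := by
  have hd : ∀ w, fderiv ℝ (fun w : P n => ∏ i, w.1 i) z w =
      ∑ i, (∏ j ∈ Finset.univ.erase i, z.1 j) * w.1 i := by
    intro w
    have := (HasFDerivAt.finsetProd (u := Finset.univ) (x := z)
      fun (i : Fin n) _ => (differentiableAt_coord (Sum.inl i) z).hasFDerivAt).fderiv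
    erw [this]
    rw [sum_apply]
    refine Finset.sum_congr rfl fun i _ => ?_
    rw [smul_apply, fderiv_coord]
    rfl
  have hA : ∀ i : Fin n, ∑ j, (∏ l ∈ Finset.univ.erase j, z.1 l) * (dirA i).1 j =
      ∏ l ∈ Finset.univ.erase i, z.1 l := by
    intro i
    simp [dirA, Pi.single_apply]
  have hB : ∀ i : Fin n, ∑ j, (∏ l ∈ Finset.univ.erase j, z.1 l) * (dirB i).1 j = 0 := by
    intro i
    simp [dirB]
  rw [braT_eq_sum_dir]
  simp only [hd, hA, hB, mul_zero, sub_zero, ← mul_assoc,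
    Finset.mul_prod_erase _ _ (Finset.mem_univ _), ← Finset.mul_sum]
  simp only [fderiv_dirB, sum_sub_cyc (fun i => pb h i z), mul_zero]

lemma eq_of_eq_cyc {n : ℕ} {y : Fin n → ℝ} (hy : ∀ i, y i = y (cyc i)) (i j : Fin n) :
    y i = y j := by
  have h0 : ∀ (m : ℕ) (hm : m < n), y ⟨m, hm⟩ = y ⟨0, by omega⟩ := by
    intro m
    induction m with
    | zero => intro _; rfl
    | succ m ih =>
      intro hm
      rw [← ih (by omega), hy ⟨m, by omega⟩]
      simp [cyc, hm]
  rw [h0 i i.2, h0 j j.2]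

/-- The block of brackets `{a_i, b_j}`. -/
def mixedBlock {n : ℕ} (a : Fin n → ℝ) : Matrix (Fin n) (Fin n) ℝ :=
  Matrix.of fun i j => a i * ((Pi.single i 1 : Fin n → ℝ) j - (Pi.single (cyc i) 1 : Fin n → ℝ) j)

lemma mixedBlock_mulVec {n : ℕ} (a y : Fin n → ℝ) (i : Fin n) :
    (mixedBlock a).mulVec y i = a i * (y i - y (cyc i)) := by
  simp [mixedBlock, Matrix.mulVec, dotProduct, mul_assoc, ← Finset.mul_sum, sub_mul,
    Finset.sum_sub_distrib, Pi.single_apply]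

lemma mixedBlock_rank {n : ℕ} (hn : 0 < n) {a : Fin n → ℝ}
    (ha : (∑ i, ∏ j ∈ Finset.univ.erase i, a j) ≠ 0) : (mixedBlock a).rank = n - 1 := by
  obtain ⟨i₀, -, hi₀⟩ := Finset.exists_ne_zero_of_sum_ne_zero ha
  have hne : ∀ i, i ≠ i₀ → a i ≠ 0 := fun i hi =>
    Finset.prod_ne_zero_iff.mp hi₀ i (by simp [hi])
  have hker : LinearMap.ker (mixedBlock a).mulVecLin = Submodule.span ℝ {(1 : Fin n → ℝ)} := by
    ext y
    rw [LinearMap.mem_ker, Submodule.mem_span_singleton, Matrix.mulVecLin_apply]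
    constructor
    · intro hy
      have h1 : ∀ i, i ≠ i₀ → y i - y (cyc i) = 0 := fun i hi =>
        (mul_eq_zero.mp ((mixedBlock_mulVec a y i).symm.trans (congrFun hy i))).resolve_left
          (hne i hi)
      have h2 : y i₀ - y (cyc i₀) = 0 := by
        rw [← sum_sub_cyc y]
        exact (Finset.sum_eq_single i₀ (fun i _ hi => h1 i hi) (by simp)).symm
      have h3 : ∀ i, y i = y (cyc i) := fun i => by
        by_cases hi : i = i₀
        · subst hi; linarith
        · linarith [h1 i hi]
      exact ⟨y i₀, funext fun j => by simp [eq_of_eq_cyc h3 i₀ j]⟩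
    · rintro ⟨c, rfl⟩
      funext i
      rw [mixedBlock_mulVec]
      simp
  have hone : (1 : Fin n → ℝ) ≠ 0 := fun h => one_ne_zero (congrFun h ⟨0, hn⟩)
  have hdim := LinearMap.finrank_range_add_finrank_ker (mixedBlock a).mulVecLin
  rw [hker, finrank_span_singleton hone, Module.finrank_fin_fun] at hdim
  rw [Matrix.rank]
  omega

lemma finrank_submodule_prod {K V W : Type*} [Field K] [AddCommGroup V] [Module K V]
    [AddCommGroup W] [Module K W] [FiniteDimensional K V] [FiniteDimensional K W]
    (p : Submodule K V) (q : Submodule K W) :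
    Module.finrank K (p.prod q) = Module.finrank K p + Module.finrank K q := by
  have h : LinearMap.range (p.subtype.prodMap q.subtype) = p.prod q := by
    rw [LinearMap.range_prodMap, p.range_subtype, q.range_subtype]
  rw [← h, LinearMap.finrank_range_of_inj (p.subtype_injective.prodMap q.subtype_injective),
    Module.finrank_prod]

lemma rank_fromBlocks_zero₁₁_zero₂₂ {K l m n o : Type*} [Field K] [Fintype l] [Fintype m]
    [Fintype n] [Fintype o] (B : Matrix n m K) (C : Matrix o l K) :
    (Matrix.fromBlocks 0 B C 0).rank = B.rank + C.rank := by
  let e := LinearEquiv.sumArrowLequivProdArrow n o K K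
  have hmap : (LinearMap.range (Matrix.fromBlocks 0 B C 0).mulVecLin).map e.toLinearMap =
      (LinearMap.range B.mulVecLin).prod (LinearMap.range C.mulVecLin) := by
    ext ⟨p, q⟩
    simp only [Submodule.mem_map, Submodule.mem_prod, LinearMap.mem_range, Matrix.mulVecLin_apply]
    constructor
    · rintro ⟨_, ⟨v, rfl⟩, hv⟩
      rw [Matrix.fromBlocks_mulVec] at hv
      have hp := congrArg Prod.fst hv
      have hq := congrArg Prod.snd hv
      refine ⟨⟨v ∘ Sum.inr, ?_⟩, ⟨v ∘ Sum.inl, ?_⟩⟩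
      · refine Eq.trans ?_ hp
        funext i
        simp [e]
      · refine Eq.trans ?_ hq
        funext i
        simp [e]
    · rintro ⟨⟨x, rfl⟩, ⟨y, rfl⟩⟩
      refine ⟨_, ⟨Sum.elim y x, rfl⟩, ?_⟩
      rw [Matrix.fromBlocks_mulVec]
      ext i <;> simp [e]
  rw [Matrix.rank, ← LinearEquiv.finrank_map_eq e, hmap,
    finrank_submodule_prod]
  rfl

lemma braT_coord_matrix {n : ℕ} (z : P n) :
    (Matrix.of fun u v => braT (coord u) (coord v) z) =
      Matrix.fromBlocks 0 (mixedBlock z.1) (-(mixedBlock z.1).transpose) 0 := by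
  ext u v
  rw [Matrix.of_apply, braT_eq_sum_dir]
  simp only [fderiv_coord]
  rcases u with i | i <;> rcases v with j | j <;>
    simp [coord, dirA, dirB, mixedBlock, Pi.single_apply]

theorem toda_bracket_jacobi_casimirs_rank (n : ℕ) (hn : 2 ≤ n) :
    (∀ g h k : P n → ℝ,
        ContDiff ℝ (⊤ : ℕ∞) g → ContDiff ℝ (⊤ : ℕ∞) h → ContDiff ℝ (⊤ : ℕ∞) k →
        ∀ z, braT g (braT h k) z + braT h (braT k g) z + braT k (braT g h) z = 0) ∧
    (∀ h : P n → ℝ, ContDiff ℝ (⊤ : ℕ∞) h →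
        ∀ z, braT (fun w => ∑ i, w.2 i) h z = 0) ∧
    (∀ h : P n → ℝ, ContDiff ℝ (⊤ : ℕ∞) h →
        ∀ z, braT (fun w => ∏ i, w.1 i) h z = 0) ∧
    (∀ z : P n, (∑ i, ∏ j ∈ Finset.univ.erase i, z.1 j) ≠ 0 →
        Matrix.rank (Matrix.of fun u v => braT (coord u) (coord v) z) = 2 * n - 2) := by
  refine ⟨fun g h k hg hh hk z => braT_jacobi hg hh hk z, fun h _ z => braT_sum_b h z,
    fun h _ z => braT_prod_a h z, fun z hz => ?_⟩
  have hneg : (-(mixedBlock z.1).transpose).rank = (mixedBlock z.1).transpose.rank := by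
    rw [← neg_one_smul ℝ]
    exact Matrix.rank_smul_of_mem_nonZeroDivisors _ (by simp)
  rw [braT_coord_matrix, rank_fromBlocks_zero₁₁_zero₂₂, hneg, Matrix.rank_transpose,
    mixedBlock_rank (by omega) hz]
  omega

end
end Damianou15
end

section
/- Let n ≥ 3. On ℝ^{2n} with coordinates (a₁,…,a_n,b₁,…,b_n) and cyclic conventions a_{n+1} = a₁, b_{n+1} = b₁, define the bracket {g,h} = Σ_{j=1}^{n} [ a_j a_{j+1} (∂g/∂a_j ∂h/∂a_{j+1} − ∂h/∂a_j ∂g/∂a_{j+1}) + (∂g/∂b_j ∂h/∂b_{j+1} − ∂h/∂b_j ∂g/∂b_{j+1}) ]. Then {·,·} satisfies the Jacobi identity for all smooth functions, and the functions C₁ = b₁ + b₂ + ⋯ + b_n and C₂ = a₁a₂⋯a_n are Casimirs: {C₁,h} = {C₂,h} = 0 for every smooth h. -/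
/-!
STATEMENT 16.  The bracket
`{g,h} = Σ_j [a_j a_{j+1}(∂g/∂a_j ∂h/∂a_{j+1} - ∂h/∂a_j ∂g/∂a_{j+1})
              + (∂g/∂b_j ∂h/∂b_{j+1} - ∂h/∂b_j ∂g/∂b_{j+1})]`
on `ℝ^{2n}` (cyclic conventions) satisfies the Jacobi identity and admits
`C₁ = Σ b_i` and `C₂ = Π a_i` as Casimirs.
-/

namespace Damianou16

noncomputable section

abbrev P (n : ℕ) := (Fin n → ℝ) × (Fin n → ℝ)

/-- Cyclic successor on `Fin n`. -/
def cyc {n : ℕ} (i : Fin n) : Fin n :=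
  if h : (i : ℕ) + 1 < n then ⟨(i : ℕ) + 1, h⟩ else ⟨0, by have := i.isLt; omega⟩

def pa {n : ℕ} (g : P n → ℝ) (i : Fin n) (z : P n) : ℝ :=
  fderiv ℝ g z (Pi.single i 1, 0)

def pb {n : ℕ} (g : P n → ℝ) (i : Fin n) (z : P n) : ℝ :=
  fderiv ℝ g z (0, Pi.single i 1)

/-- The bracket of (new-poisson-vol). -/
def braV {n : ℕ} (g h : P n → ℝ) : P n → ℝ :=
  fun z => ∑ j,
    (z.1 j * z.1 (cyc j) * (pa g j z * pa h (cyc j) z - pa h j z * pa g (cyc j) z) +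
     (pb g j z * pb h (cyc j) z - pb h j z * pb g (cyc j) z))

/-- The derivative of `g` along the vector field `V`. -/
def dirDeriv {E : Type*} [NormedAddCommGroup E] [NormedSpace ℝ E]
    (V : E → E) (g : E → ℝ) (z : E) : ℝ :=
  fderiv ℝ g z (V z)

/-- The bracket `∑ i, X i ∧ Y i` built from two families of vector fields. -/
def wedgeBracket {E ι : Type*} [NormedAddCommGroup E] [NormedSpace ℝ E] [Fintype ι]
    (X Y : ι → E → E) (g h : E → ℝ) (z : E) : ℝ :=
  ∑ i, (dirDeriv (X i) g z * dirDeriv (Y i) h z - dirDeriv (X i) h z * dirDeriv (Y i) g z)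

section General

variable {E : Type*} [NormedAddCommGroup E] [NormedSpace ℝ E]

lemma contDiff_dirDeriv {V : E → E} {g : E → ℝ} (hV : ContDiff ℝ (⊤ : ℕ∞) V)
    (hg : ContDiff ℝ (⊤ : ℕ∞) g) : ContDiff ℝ (⊤ : ℕ∞) (dirDeriv V g) :=
  (hg.fderiv_right (m := ((⊤ : ℕ∞) : WithTop ℕ∞)) (by simp)).clm_apply hV

lemma dirDeriv_comm {V W : E → E} {g : E → ℝ} (hV : ContDiff ℝ (⊤ : ℕ∞) V)
    (hW : ContDiff ℝ (⊤ : ℕ∞) W) (hg : ContDiff ℝ (⊤ : ℕ∞) g)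
    (hVW : ∀ z, fderiv ℝ V z (W z) = fderiv ℝ W z (V z)) (z : E) :
    dirDeriv V (dirDeriv W g) z = dirDeriv W (dirDeriv V g) z := by
  have hg' : DifferentiableAt ℝ (fderiv ℝ g) z :=
    ((hg.fderiv_right (m := ((⊤ : ℕ∞) : WithTop ℕ∞)) (by simp)).differentiable (by simp)) z
  have key : ∀ {U : E → E}, ContDiff ℝ (⊤ : ℕ∞) U → ∀ v,
      fderiv ℝ (dirDeriv U g) z v
        = fderiv ℝ (fderiv ℝ g) z v (U z) + fderiv ℝ g z (fderiv ℝ U z v) := by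
    intro U hU v
    have h := hg'.hasFDerivAt.clm_apply ((hU.differentiable (by simp)) z).hasFDerivAt
    have h' : HasFDerivAt (dirDeriv U g) _ z := h
    rw [h'.fderiv]
    simp [add_comm]
  have hs : IsSymmSndFDerivAt ℝ g z :=
    (hg.of_le (WithTop.coe_le_coe.mpr (le_top : (2 : ℕ∞) ≤ ⊤))).contDiffAt.isSymmSndFDerivAt (n := 2) (by simp)
  change fderiv ℝ (dirDeriv W g) z (V z) = fderiv ℝ (dirDeriv V g) z (W z)
  rw [key hW, key hV, hs.eq (V z) (W z), hVW]

variable {ι : Type*} [Fintype ι]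

lemma dirDeriv_wedgeBracket {X Y : ι → E → E} (hX : ∀ i, ContDiff ℝ (⊤ : ℕ∞) (X i))
    (hY : ∀ i, ContDiff ℝ (⊤ : ℕ∞) (Y i)) {g h : E → ℝ} (hg : ContDiff ℝ (⊤ : ℕ∞) g)
    (hh : ContDiff ℝ (⊤ : ℕ∞) h) (V : E → E) (z : E) :
    dirDeriv V (wedgeBracket X Y g h) z = ∑ i,
      (dirDeriv V (dirDeriv (X i) g) z * dirDeriv (Y i) h z
        + dirDeriv (X i) g z * dirDeriv V (dirDeriv (Y i) h) z
        - (dirDeriv V (dirDeriv (X i) h) z * dirDeriv (Y i) g z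
        + dirDeriv (X i) h z * dirDeriv V (dirDeriv (Y i) g) z)) := by
  have d : ∀ {U : E → E} {f : E → ℝ}, ContDiff ℝ (⊤ : ℕ∞) U → ContDiff ℝ (⊤ : ℕ∞) f →
      HasFDerivAt (dirDeriv U f) (fderiv ℝ (dirDeriv U f) z) z := fun hU hf =>
    (((contDiff_dirDeriv hU hf).differentiable (by simp)) z).hasFDerivAt
  have H : HasFDerivAt (wedgeBracket X Y g h) _ z :=
    HasFDerivAt.fun_sum (u := Finset.univ) fun i _ =>
      ((d (hX i) hg).mul (d (hY i) hh)).sub ((d (hX i) hh).mul (d (hY i) hg))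
  rw [dirDeriv, H.fderiv, sum_apply]
  refine Finset.sum_congr rfl fun i _ => ?_
  simp only [sub_apply, add_apply,
    smul_apply, smul_eq_mul]
  simp only [dirDeriv]
  ring

/-- A bivector with constant coefficients in pairwise commuting vector fields is Poisson. -/
theorem wedgeBracket_jacobi {X Y : ι → E → E} (hX : ∀ i, ContDiff ℝ (⊤ : ℕ∞) (X i))
    (hY : ∀ i, ContDiff ℝ (⊤ : ℕ∞) (Y i))
    (hXX : ∀ i j z, fderiv ℝ (X i) z (X j z) = fderiv ℝ (X j) z (X i z))
    (hXY : ∀ i j z, fderiv ℝ (X i) z (Y j z) = fderiv ℝ (Y j) z (X i z))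
    (hYY : ∀ i j z, fderiv ℝ (Y i) z (Y j z) = fderiv ℝ (Y j) z (Y i z))
    {g h k : E → ℝ} (hg : ContDiff ℝ (⊤ : ℕ∞) g) (hh : ContDiff ℝ (⊤ : ℕ∞) h)
    (hk : ContDiff ℝ (⊤ : ℕ∞) k) (z : E) :
    wedgeBracket X Y g (wedgeBracket X Y h k) z + wedgeBracket X Y h (wedgeBracket X Y k g) z
      + wedgeBracket X Y k (wedgeBracket X Y g h) z = 0 := by
  let T : (E → ℝ) → (E → ℝ) → (E → ℝ) → ι → ι → ℝ := fun g h k i j =>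
    dirDeriv (X i) g z *
      (dirDeriv (Y i) (dirDeriv (X j) h) z * dirDeriv (Y j) k z
        + dirDeriv (X j) h z * dirDeriv (Y i) (dirDeriv (Y j) k) z
        - (dirDeriv (Y i) (dirDeriv (X j) k) z * dirDeriv (Y j) h z
        + dirDeriv (X j) k z * dirDeriv (Y i) (dirDeriv (Y j) h) z))
    - (dirDeriv (X i) (dirDeriv (X j) h) z * dirDeriv (Y j) k z
        + dirDeriv (X j) h z * dirDeriv (X i) (dirDeriv (Y j) k) z
        - (dirDeriv (X i) (dirDeriv (X j) k) z * dirDeriv (Y j) h z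
        + dirDeriv (X j) k z * dirDeriv (X i) (dirDeriv (Y j) h) z)) * dirDeriv (Y i) g z
  have expand : ∀ {g h k : E → ℝ}, ContDiff ℝ (⊤ : ℕ∞) h → ContDiff ℝ (⊤ : ℕ∞) k →
      wedgeBracket X Y g (wedgeBracket X Y h k) z = ∑ i, ∑ j, T g h k i j := by
    intro g h k hh hk
    rw [wedgeBracket]
    refine Finset.sum_congr rfl fun i _ => ?_
    rw [dirDeriv_wedgeBracket hX hY hh hk, dirDeriv_wedgeBracket hX hY hh hk,
      Finset.mul_sum, Finset.sum_mul, ← Finset.sum_sub_distrib]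
  let S : ι → ι → ℝ := fun i j => T g h k i j + T h k g i j + T k g h i j
  have anti : ∀ i j, S i j = -S j i := by
    intro i j
    have xx : ∀ {f : E → ℝ}, ContDiff ℝ (⊤ : ℕ∞) f →
        dirDeriv (X j) (dirDeriv (X i) f) z = dirDeriv (X i) (dirDeriv (X j) f) z :=
      fun hf => dirDeriv_comm (hX j) (hX i) hf (hXX j i) z
    have yy : ∀ {f : E → ℝ}, ContDiff ℝ (⊤ : ℕ∞) f →
        dirDeriv (Y j) (dirDeriv (Y i) f) z = dirDeriv (Y i) (dirDeriv (Y j) f) z :=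
      fun hf => dirDeriv_comm (hY j) (hY i) hf (hYY j i) z
    have xy : ∀ (i j) {f : E → ℝ}, ContDiff ℝ (⊤ : ℕ∞) f →
        dirDeriv (X i) (dirDeriv (Y j) f) z = dirDeriv (Y j) (dirDeriv (X i) f) z :=
      fun i j _ hf => dirDeriv_comm (hX i) (hY j) hf (hXY i j) z
    simp only [S, T, xx hg, xx hh, xx hk, yy hg, yy hh, yy hk, xy i j hg, xy i j hh, xy i j hk,
      xy j i hg, xy j i hh, xy j i hk]
    ring
  have total : ∑ i, ∑ j, S i j = -∑ i, ∑ j, S i j := by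
    conv_lhs => rw [Finset.sum_comm]
    simp only [← Finset.sum_neg_distrib]
    exact Finset.sum_congr rfl fun i _ => Finset.sum_congr rfl fun j _ => anti j i
  rw [expand hh hk, expand hk hg, expand hg hh]
  simp only [S, Finset.sum_add_distrib] at total
  linarith

end General

/-- The vector fields `a_i ∂/∂a_i` and `∂/∂b_i`. -/
def logField {n : ℕ} : Fin n ⊕ Fin n → P n → P n
  | .inl i => fun z => (Pi.single i (z.1 i), 0)
  | .inr i => fun _ => (0, Pi.single i 1)

/-- The linear vector field `a_i ∂/∂a_i` as a continuous linear map. -/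
def logLinear {n : ℕ} (i : Fin n) : P n →L[ℝ] P n :=
  (ContinuousLinearMap.inl ℝ (Fin n → ℝ) (Fin n → ℝ)).comp
    ((ContinuousLinearMap.single ℝ (fun _ : Fin n => ℝ) i).comp
      ((ContinuousLinearMap.proj i).comp (ContinuousLinearMap.fst ℝ (Fin n → ℝ) (Fin n → ℝ))))

lemma contDiff_logField {n : ℕ} (s : Fin n ⊕ Fin n) : ContDiff ℝ (⊤ : ℕ∞) (logField s) := by
  rcases s with i | i
  · exact (logLinear i).contDiff
  · exact contDiff_const

lemma fderiv_logField_comm {n : ℕ} (s t : Fin n ⊕ Fin n) (z : P n) :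
    fderiv ℝ (logField s) z (logField t z) = fderiv ℝ (logField t) z (logField s z) := by
  have hr : ∀ i : Fin n, fderiv ℝ (logField (.inr i)) z = 0 := fun i =>
    (hasFDerivAt_const ((0, Pi.single i 1) : P n) z).fderiv
  have hl : ∀ i : Fin n, fderiv ℝ (logField (.inl i)) z = logLinear i := fun i =>
    (logLinear i).fderiv
  rcases s with i | i <;> rcases t with j | j <;> simp only [hr, hl]
  · rcases eq_or_ne i j with rfl | hij
    · rfl
    · simp [logField, logLinear, hij, hij.symm]
  · simp [logField, logLinear]
  · simp [logField, logLinear, Prod.zero_eq_mk]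
  · rfl

lemma dirDeriv_logField_inl {n : ℕ} (i : Fin n) (g : P n → ℝ) (z : P n) :
    dirDeriv (logField (.inl i)) g z = z.1 i * pa g i z := by
  have : logField (.inl i) z = z.1 i • ((Pi.single i 1, 0) : P n) := by
    simp [logField, ← Pi.single_smul]
  rw [dirDeriv, this, map_smul, smul_eq_mul, pa]

lemma braV_eq_wedgeBracket {n : ℕ} (g h : P n → ℝ) :
    braV g h = wedgeBracket logField (fun s => logField (Sum.map cyc cyc s)) g h := by
  funext z
  simp only [braV, wedgeBracket, Fintype.sum_sum_type, Sum.map_inl, Sum.map_inr,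
    dirDeriv_logField_inl, Finset.sum_add_distrib]
  congr 1
  exact Finset.sum_congr rfl fun i _ => by ring

lemma cyc_bijective {n : ℕ} : Function.Bijective (cyc : Fin n → Fin n) := by
  refine Finite.injective_iff_bijective.mp fun i j hij => ?_
  have := congrArg Fin.val hij
  unfold cyc at this
  ext
  split_ifs at this <;> simp at this <;> omega

lemma sum_cyc_sub {n : ℕ} (f : Fin n → ℝ) : ∑ j, (f (cyc j) - f j) = 0 := by
  rw [Finset.sum_sub_distrib, cyc_bijective.sum_comp f, sub_self]

lemma hasFDerivAt_sum_snd {n : ℕ} (z : P n) :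
    HasFDerivAt (fun w : P n => ∑ i, w.2 i)
      (∑ i, (ContinuousLinearMap.proj (R := ℝ) (φ := fun _ : Fin n => ℝ) i).comp
        (ContinuousLinearMap.snd ℝ (Fin n → ℝ) (Fin n → ℝ))) z :=
  HasFDerivAt.fun_sum fun i _ => ContinuousLinearMap.hasFDerivAt
    ((ContinuousLinearMap.proj (R := ℝ) (φ := fun _ : Fin n => ℝ) i).comp
      (ContinuousLinearMap.snd ℝ (Fin n → ℝ) (Fin n → ℝ)))

lemma hasFDerivAt_prod_fst {n : ℕ} (z : P n) :
    HasFDerivAt (fun w : P n => ∏ i, w.1 i)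
      (∑ i, (∏ j ∈ Finset.univ.erase i, z.1 j) •
        (ContinuousLinearMap.proj (R := ℝ) (φ := fun _ : Fin n => ℝ) i).comp
          (ContinuousLinearMap.fst ℝ (Fin n → ℝ) (Fin n → ℝ))) z :=
  HasFDerivAt.finsetProd fun i _ => ContinuousLinearMap.hasFDerivAt
    ((ContinuousLinearMap.proj (R := ℝ) (φ := fun _ : Fin n => ℝ) i).comp
      (ContinuousLinearMap.fst ℝ (Fin n → ℝ) (Fin n → ℝ)))

lemma mul_pa_prod_fst {n : ℕ} (j : Fin n) (z : P n) :
    z.1 j * pa (fun w : P n => ∏ i, w.1 i) j z = ∏ i, z.1 i := by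
  rw [pa, (hasFDerivAt_prod_fst z).fderiv]
  simp [Pi.single_apply, Finset.mul_prod_erase]

lemma pb_prod_fst {n : ℕ} (j : Fin n) (z : P n) :
    pb (fun w : P n => ∏ i, w.1 i) j z = 0 := by
  rw [pb, (hasFDerivAt_prod_fst z).fderiv]
  simp

lemma pa_sum_snd {n : ℕ} (j : Fin n) (z : P n) :
    pa (fun w : P n => ∑ i, w.2 i) j z = 0 := by
  rw [pa, (hasFDerivAt_sum_snd z).fderiv]
  simp

lemma pb_sum_snd {n : ℕ} (j : Fin n) (z : P n) :
    pb (fun w : P n => ∑ i, w.2 i) j z = 1 := by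
  rw [pb, (hasFDerivAt_sum_snd z).fderiv]
  simp [Pi.single_apply]

theorem volterra_times_constant_bracket_jacobi_casimirs (n : ℕ) (hn : 3 ≤ n) :
    (∀ g h k : P n → ℝ,
        ContDiff ℝ (⊤ : ℕ∞) g → ContDiff ℝ (⊤ : ℕ∞) h → ContDiff ℝ (⊤ : ℕ∞) k →
        ∀ z, braV g (braV h k) z + braV h (braV k g) z + braV k (braV g h) z = 0) ∧
    (∀ h : P n → ℝ, ContDiff ℝ (⊤ : ℕ∞) h →
        ∀ z, braV (fun w => ∑ i, w.2 i) h z = 0) ∧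
    (∀ h : P n → ℝ, ContDiff ℝ (⊤ : ℕ∞) h →
        ∀ z, braV (fun w => ∏ i, w.1 i) h z = 0) := by
  refine ⟨fun g h k hg hh hk z => ?_, fun h _ z => ?_, fun h _ z => ?_⟩
  · simp only [braV_eq_wedgeBracket]
    exact wedgeBracket_jacobi contDiff_logField (fun _ => contDiff_logField _)
      fderiv_logField_comm (fun _ _ => fderiv_logField_comm _ _)
      (fun _ _ => fderiv_logField_comm _ _) hg hh hk z
  · simp only [braV, pa_sum_snd, pb_sum_snd]
    refine Eq.trans ?_ (sum_cyc_sub fun j => pb h j z)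
    exact Finset.sum_congr rfl fun j _ => by ring
  · simp only [braV, pb_prod_fst]
    have hs := congrArg (fun t => (∏ i, z.1 i) * t) (sum_cyc_sub fun j => z.1 j * pa h j z)
    simp only [mul_zero, Finset.mul_sum] at hs
    refine Eq.trans ?_ hs
    refine Finset.sum_congr rfl fun j _ => ?_
    linear_combination z.1 (cyc j) * pa h (cyc j) z * mul_pa_prod_fst j z
      - z.1 j * pa h j z * mul_pa_prod_fst (cyc j) z

end
end Damianou16
end

section
/- On ℝ⁹ with coordinates (x₁,x₂,x₃,y₁,y₂,y₃,z₁,z₂,z₃), consider the unique antisymmetric biderivation bracket {·,·} on smooth functions determined on coordinates by: {x₁,y₁} = −y₁, {x₁,y₃} = y₃, {x₁,z₁} = −z₁, {x₁,z₂} = z₂, {x₂,y₁} = y₁, {x₂,y₂} = −y₂, {x₂,z₂} = −z₂, {x₂,z₃} = z₃, {x₃,y₂} = y₂, {x₃,y₃} = −y₃, {x₃,z₁} = z₁, {x₃,z₃} = −z₃, {y₁,y₂} = −z₁, {y₁,y₃} = z₃, {y₂,y₃} = −z₂, and all other brackets of coordinate functions equal to zero (i.e. {g,h} = Σ_{u,v}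 {u,v} ∂g/∂u ∂h/∂v over the coordinate pairs). Then this bracket satisfies the Jacobi identity for all smooth functions, and the functions C₁ = x₁ + x₂ + x₃, C₂ = y₁z₂ + y₂z₃ + y₃z₁ and C₃ = z₁z₂z₃ are Casimirs: {C_i,h} = 0 for i = 1,2,3 and every smooth h. -/
/-!
STATEMENT 18.  The linear Lie–Poisson bracket on `ℝ⁹ = gl(3,ℝ)` determined by
the listed coordinate brackets satisfies the Jacobi identity and admits
`C₁ = x₁+x₂+x₃`, `C₂ = y₁z₂+y₂z₃+y₃z₁`, `C₃ = z₁z₂z₃` as Casimirs.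
-/

namespace Damianou18

noncomputable section

/-- `ℝ⁹` with coordinates `(x₁,x₂,x₃,y₁,y₂,y₃,z₁,z₂,z₃)`. -/
abbrev T := (Fin 3 → ℝ) × (Fin 3 → ℝ) × (Fin 3 → ℝ)

def px (g : T → ℝ) (i : Fin 3) (w : T) : ℝ := fderiv ℝ g w (Pi.single i 1, 0, 0)
def py (g : T → ℝ) (i : Fin 3) (w : T) : ℝ := fderiv ℝ g w (0, Pi.single i 1, 0)
def pz (g : T → ℝ) (i : Fin 3) (w : T) : ℝ := fderiv ℝ g w (0, 0, Pi.single i 1)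

/-- The bracket `{g,h} = Σ_{u,v} {u,v} ∂g/∂u ∂h/∂v` with the listed coordinate
brackets `{x₁,y₁} = -y₁`, …, `{y₂,y₃} = -z₂` (extended antisymmetrically). -/
def bra (g h : T → ℝ) : T → ℝ := fun w =>
  (-(w.2.1 0)) * (px g 0 w * py h 0 w - px h 0 w * py g 0 w) +
  (w.2.1 2) * (px g 0 w * py h 2 w - px h 0 w * py g 2 w) +
  (-(w.2.2 0)) * (px g 0 w * pz h 0 w - px h 0 w * pz g 0 w) +
  (w.2.2 1) * (px g 0 w * pz h 1 w - px h 0 w * pz g 1 w) +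
  (w.2.1 0) * (px g 1 w * py h 0 w - px h 1 w * py g 0 w) +
  (-(w.2.1 1)) * (px g 1 w * py h 1 w - px h 1 w * py g 1 w) +
  (-(w.2.2 1)) * (px g 1 w * pz h 1 w - px h 1 w * pz g 1 w) +
  (w.2.2 2) * (px g 1 w * pz h 2 w - px h 1 w * pz g 2 w) +
  (w.2.1 1) * (px g 2 w * py h 1 w - px h 2 w * py g 1 w) +
  (-(w.2.1 2)) * (px g 2 w * py h 2 w - px h 2 w * py g 2 w) +
  (w.2.2 0) * (px g 2 w * pz h 0 w - px h 2 w * pz g 0 w) +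
  (-(w.2.2 2)) * (px g 2 w * pz h 2 w - px h 2 w * pz g 2 w) +
  (-(w.2.2 0)) * (py g 0 w * py h 1 w - py h 0 w * py g 1 w) +
  (w.2.2 2) * (py g 0 w * py h 2 w - py h 0 w * py g 2 w) +
  (-(w.2.2 1)) * (py g 1 w * py h 2 w - py h 1 w * py g 2 w)

section LinearBivector

variable {V ι : Type*} [NormedAddCommGroup V] [NormedSpace ℝ V] [Fintype ι]

/-- The bracket on the dual of `V` induced by the linear bivector `∑ i, c i • (a i ∧ b i)`. -/
def dualBracket (c : ι → V →L[ℝ] ℝ) (a b : ι → V) (φ ψ : V →L[ℝ] ℝ) : V →L[ℝ] ℝ :=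
  ∑ i, (φ (a i) * ψ (b i) - ψ (a i) * φ (b i)) • c i

/-- The Hamiltonian vector at `w` of a covector `ψ`. -/
def hamVector (c : ι → V →L[ℝ] ℝ) (a b : ι → V) (ψ : V →L[ℝ] ℝ) (w : V) : V :=
  ∑ i, c i w • (ψ (b i) • a i - ψ (a i) • b i)

variable (c : ι → V →L[ℝ] ℝ) (a b : ι → V)

lemma dualBracket_apply (φ ψ : V →L[ℝ] ℝ) (w : V) :
    dualBracket c a b φ ψ w = φ (hamVector c a b ψ w) := by
  simp only [dualBracket, hamVector, map_sum, map_smul, map_sub, smul_eq_mul,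
    sum_apply, smul_apply]
  exact Finset.sum_congr rfl fun i _ => by ring

lemma dualBracket_swap (φ ψ : V →L[ℝ] ℝ) :
    dualBracket c a b φ ψ = -dualBracket c a b ψ φ := by
  ext v
  simp only [dualBracket, neg_apply, sum_apply, smul_apply, smul_eq_mul,
    ← Finset.sum_neg_distrib]
  exact Finset.sum_congr rfl fun i _ => by ring

lemma apply_hamVector_swap (φ ψ : V →L[ℝ] ℝ) (w : V) :
    φ (hamVector c a b ψ w) = -ψ (hamVector c a b φ w) := by
  rw [← dualBracket_apply, dualBracket_swap, neg_apply, dualBracket_apply]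

lemma fderiv_dualBracket_fderiv {h k : V → ℝ} {w : V}
    (hh : DifferentiableAt ℝ (fderiv ℝ h) w) (hk : DifferentiableAt ℝ (fderiv ℝ k) w) (v : V) :
    fderiv ℝ (fun u => dualBracket c a b (fderiv ℝ h u) (fderiv ℝ k u) u) w v =
      dualBracket c a b (fderiv ℝ h w) (fderiv ℝ k w) v +
      fderiv ℝ (fderiv ℝ h) w v (hamVector c a b (fderiv ℝ k w) w) -
      fderiv ℝ (fderiv ℝ k) w v (hamVector c a b (fderiv ℝ h w) w) := by
  have ev {f : V → ℝ} (hf : DifferentiableAt ℝ (fderiv ℝ f) w) (e : V) :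
      HasFDerivAt (fun u => fderiv ℝ f u e)
        ((ContinuousLinearMap.apply ℝ ℝ e).comp (fderiv ℝ (fderiv ℝ f) w)) w :=
    (ContinuousLinearMap.apply ℝ ℝ e).hasFDerivAt.comp w hf.hasFDerivAt
  have key := HasFDerivAt.fun_sum (u := Finset.univ) fun i _ =>
    (((ev hh (a i)).fun_mul (ev hk (b i))).fun_sub ((ev hk (a i)).fun_mul (ev hh (b i)))).fun_mul
      (c i).hasFDerivAt
  simp only [dualBracket, sum_apply, smul_apply, smul_eq_mul]
  rw [key.fderiv]
  simp only [hamVector, map_sum, map_smul, map_sub, smul_eq_mul,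
    sum_apply, smul_apply, add_apply, sub_apply, ContinuousLinearMap.comp_apply,
    ContinuousLinearMap.apply_apply, ← Finset.sum_add_distrib, ← Finset.sum_sub_distrib]
  exact Finset.sum_congr rfl fun i _ => by ring

/-- A linear bivector whose dual bracket is a Lie bracket satisfies the Jacobi identity on
smooth functions. -/
lemma dualBracket_fderiv_jacobi
    (jac : ∀ φ ψ χ : V →L[ℝ] ℝ,
      dualBracket c a b φ (dualBracket c a b ψ χ) + dualBracket c a b ψ (dualBracket c a b χ φ) +
        dualBracket c a b χ (dualBracket c a b φ ψ) = 0)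
    (P : (V → ℝ) → (V → ℝ) → V → ℝ)
    (hP : ∀ g h w, P g h w = dualBracket c a b (fderiv ℝ g w) (fderiv ℝ h w) w)
    {g h k : V → ℝ} (hg : ContDiff ℝ 2 g) (hh : ContDiff ℝ 2 h) (hk : ContDiff ℝ 2 k) (w : V) :
    P g (P h k) w + P h (P k g) w + P k (P g h) w = 0 := by
  have diff {f : V → ℝ} (hf : ContDiff ℝ 2 f) : DifferentiableAt ℝ (fderiv ℝ f) w :=
    ((hf.fderiv_right (m := 1) (by norm_num)).differentiable (by norm_num)) w
  have symm {f : V → ℝ} (hf : ContDiff ℝ 2 f) (u v : V) :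
      fderiv ℝ (fderiv ℝ f) w u v = fderiv ℝ (fderiv ℝ f) w v u :=
    (hf.contDiffAt.isSymmSndFDerivAt (by simp)) u v
  have step {f₁ f₂ f₃ : V → ℝ} (h₂ : ContDiff ℝ 2 f₂) (h₃ : ContDiff ℝ 2 f₃) :
      P f₁ (P f₂ f₃) w =
        dualBracket c a b (fderiv ℝ f₁ w)
          (dualBracket c a b (fderiv ℝ f₂ w) (fderiv ℝ f₃ w)) w -
        fderiv ℝ (fderiv ℝ f₂) w (hamVector c a b (fderiv ℝ f₁ w) w)
          (hamVector c a b (fderiv ℝ f₃ w) w) +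
        fderiv ℝ (fderiv ℝ f₃) w (hamVector c a b (fderiv ℝ f₁ w) w)
          (hamVector c a b (fderiv ℝ f₂ w) w) := by
    rw [hP, dualBracket_apply, apply_hamVector_swap, funext (hP f₂ f₃),
      fderiv_dualBracket_fderiv c a b (diff h₂) (diff h₃),
      dualBracket_apply c a b _ (dualBracket ..), apply_hamVector_swap]
    ring
  have jac_w := DFunLike.congr_fun
    (jac (fderiv ℝ g w) (fderiv ℝ h w) (fderiv ℝ k w)) w
  simp only [add_apply, zero_apply] at jac_w
  rw [step hh hk, step hk hg, step hg hh,
    symm hg (hamVector c a b (fderiv ℝ h w) w), symm hh (hamVector c a b (fderiv ℝ k w) w),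
    symm hk (hamVector c a b (fderiv ℝ g w) w)]
  linarith

end LinearBivector

/-- The `i`-th basis vector in the `x` directions. -/
def ex (i : Fin 3) : T := (Pi.single i 1, 0, 0)
/-- The `i`-th basis vector in the `y` directions. -/
def ey (i : Fin 3) : T := (0, Pi.single i 1, 0)
/-- The `i`-th basis vector in the `z` directions. -/
def ez (i : Fin 3) : T := (0, 0, Pi.single i 1)

/-- The coordinate `xᵢ`. -/
def cx (i : Fin 3) : T →L[ℝ] ℝ :=
  (ContinuousLinearMap.proj i).comp (ContinuousLinearMap.fst ℝ _ _)
/-- The coordinate `yᵢ`. -/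
def cy (i : Fin 3) : T →L[ℝ] ℝ :=
  (ContinuousLinearMap.proj i).comp
    ((ContinuousLinearMap.fst ℝ _ _).comp (ContinuousLinearMap.snd ℝ (Fin 3 → ℝ) _))
/-- The coordinate `zᵢ`. -/
def cz (i : Fin 3) : T →L[ℝ] ℝ :=
  (ContinuousLinearMap.proj i).comp
    ((ContinuousLinearMap.snd ℝ _ _).comp (ContinuousLinearMap.snd ℝ (Fin 3 → ℝ) _))

lemma cx_apply (i : Fin 3) (w : T) : cx i w = w.1 i := rfl
lemma cy_apply (i : Fin 3) (w : T) : cy i w = w.2.1 i := rfl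
lemma cz_apply (i : Fin 3) (w : T) : cz i w = w.2.2 i := rfl

/-- The coefficients of the bivector of `bra`. -/
def coeff : Fin 15 → T →L[ℝ] ℝ :=
  ![-cy 0, cy 2, -cz 0, cz 1, cy 0, -cy 1, -cz 1, cz 2, cy 1, -cy 2, cz 0, -cz 2,
    -cz 0, cz 2, -cz 1]
/-- The first directions of the bivector of `bra`. -/
def dirL : Fin 15 → T :=
  ![ex 0, ex 0, ex 0, ex 0, ex 1, ex 1, ex 1, ex 1, ex 2, ex 2, ex 2, ex 2, ey 0, ey 0, ey 1]
/-- The second directions of the bivector of `bra`. -/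
def dirR : Fin 15 → T :=
  ![ey 0, ey 2, ez 0, ez 1, ey 0, ey 1, ez 1, ez 2, ey 1, ey 2, ez 0, ez 2, ey 1, ey 2, ey 2]

lemma dualBracket_eq (φ ψ : T →L[ℝ] ℝ) :
    dualBracket coeff dirL dirR φ ψ =
      (φ (ex 0) * ψ (ey 0) - ψ (ex 0) * φ (ey 0)) • (-cy 0) +
      (φ (ex 0) * ψ (ey 2) - ψ (ex 0) * φ (ey 2)) • cy 2 +
      (φ (ex 0) * ψ (ez 0) - ψ (ex 0) * φ (ez 0)) • (-cz 0) +
      (φ (ex 0) * ψ (ez 1) - ψ (ex 0) * φ (ez 1)) • cz 1 +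
      (φ (ex 1) * ψ (ey 0) - ψ (ex 1) * φ (ey 0)) • cy 0 +
      (φ (ex 1) * ψ (ey 1) - ψ (ex 1) * φ (ey 1)) • (-cy 1) +
      (φ (ex 1) * ψ (ez 1) - ψ (ex 1) * φ (ez 1)) • (-cz 1) +
      (φ (ex 1) * ψ (ez 2) - ψ (ex 1) * φ (ez 2)) • cz 2 +
      (φ (ex 2) * ψ (ey 1) - ψ (ex 2) * φ (ey 1)) • cy 1 +
      (φ (ex 2) * ψ (ey 2) - ψ (ex 2) * φ (ey 2)) • (-cy 2) +
      (φ (ex 2) * ψ (ez 0) - ψ (ex 2) * φ (ez 0)) • cz 0 +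
      (φ (ex 2) * ψ (ez 2) - ψ (ex 2) * φ (ez 2)) • (-cz 2) +
      (φ (ey 0) * ψ (ey 1) - ψ (ey 0) * φ (ey 1)) • (-cz 0) +
      (φ (ey 0) * ψ (ey 2) - ψ (ey 0) * φ (ey 2)) • cz 2 +
      (φ (ey 1) * ψ (ey 2) - ψ (ey 1) * φ (ey 2)) • (-cz 1) := by
  simp only [dualBracket, Fin.sum_univ_castSucc, Finset.univ_eq_empty, Finset.sum_empty, zero_add]
  rfl

lemma bra_eq_dualBracket (g h : T → ℝ) (w : T) :
    bra g h w = dualBracket coeff dirL dirR (fderiv ℝ g w) (fderiv ℝ h w) w := by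
  simp only [dualBracket_eq, add_apply, smul_apply,
    neg_apply, cy_apply, cz_apply, smul_eq_mul, bra, px, py, pz, ex, ey, ez]
  ring

lemma dualBracket_jacobi (φ ψ χ : T →L[ℝ] ℝ) :
    dualBracket coeff dirL dirR φ (dualBracket coeff dirL dirR ψ χ) +
      dualBracket coeff dirL dirR ψ (dualBracket coeff dirL dirR χ φ) +
      dualBracket coeff dirL dirR χ (dualBracket coeff dirL dirR φ ψ) = 0 := by
  have yx (i j) : cy i (ex j) = 0 := rfl
  have zx (i j) : cz i (ex j) = 0 := rfl
  have yz (i j) : cy i (ez j) = 0 := rfl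
  have zy (i j) : cz i (ey j) = 0 := rfl
  have yy (i j) : cy i (ey j) = if i = j then 1 else 0 := Pi.single_apply j (1 : ℝ) i
  have zz (i j) : cz i (ez j) = if i = j then 1 else 0 := Pi.single_apply j (1 : ℝ) i
  refine ContinuousLinearMap.ext fun w => ?_
  simp [dualBracket_eq, yx, zx, yz, zy, yy, zz]
  ring

theorem gl3_lie_poisson_jacobi_casimirs :
    (∀ g h k : T → ℝ,
        ContDiff ℝ (⊤ : ℕ∞) g → ContDiff ℝ (⊤ : ℕ∞) h → ContDiff ℝ (⊤ : ℕ∞) k →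
        ∀ w, bra g (bra h k) w + bra h (bra k g) w + bra k (bra g h) w = 0) ∧
    (∀ h : T → ℝ, ContDiff ℝ (⊤ : ℕ∞) h →
        ∀ w, bra (fun v => v.1 0 + v.1 1 + v.1 2) h w = 0) ∧
    (∀ h : T → ℝ, ContDiff ℝ (⊤ : ℕ∞) h →
        ∀ w, bra (fun v => v.2.1 0 * v.2.2 1 + v.2.1 1 * v.2.2 2 + v.2.1 2 * v.2.2 0) h w = 0) ∧
    (∀ h : T → ℝ, ContDiff ℝ (⊤ : ℕ∞) h →
        ∀ w, bra (fun v => v.2.2 0 * v.2.2 1 * v.2.2 2) h w = 0) := by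
  have dx (i : Fin 3) (w : T) : HasFDerivAt (fun v : T => v.1 i) (cx i) w := (cx i).hasFDerivAt
  have dy (i : Fin 3) (w : T) : HasFDerivAt (fun v : T => v.2.1 i) (cy i) w := (cy i).hasFDerivAt
  have dz (i : Fin 3) (w : T) : HasFDerivAt (fun v : T => v.2.2 i) (cz i) w := (cz i).hasFDerivAt
  refine ⟨fun g h k hg hh hk w => ?_, fun h _ w => ?_, fun h _ w => ?_, fun h _ w => ?_⟩
  · exact dualBracket_fderiv_jacobi coeff dirL dirR dualBracket_jacobi bra bra_eq_dualBracket
      (contDiff_infty.1 hg 2) (contDiff_infty.1 hh 2) (contDiff_infty.1 hk 2) w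
  · have d := ((dx 0 w).add (dx 1 w)).add (dx 2 w)
    simp [bra, px, py, pz, HasFDerivAt.fderiv (f := fun v : T => v.1 0 + v.1 1 + v.1 2) d,
      cx_apply]
    ring
  · have d := (((dy 0 w).mul (dz 1 w)).add ((dy 1 w).mul (dz 2 w))).add ((dy 2 w).mul (dz 0 w))
    simp [bra, px, py, pz, HasFDerivAt.fderiv
      (f := fun v : T => v.2.1 0 * v.2.2 1 + v.2.1 1 * v.2.2 2 + v.2.1 2 * v.2.2 0) d,
      cy_apply, cz_apply]
    ring
  · have d := ((dz 0 w).mul (dz 1 w)).mul (dz 2 w)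
    simp [bra, px, py, pz, HasFDerivAt.fderiv
      (f := fun v : T => v.2.2 0 * v.2.2 1 * v.2.2 2) d, cz_apply]
    ring

end
end Damianou18
end
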